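/- Let N ≥ 2, let f ∈ L^1(S^N) and let α > (N-1)/2. Then the Fourier–Laplace series of f is Cesàro summable of order α to f almost everywhere on the sphere: lim_{n→∞} S_n^α f(x) = f(x) for σ-almost every x ∈ S^N. -/

import Mathlib

open MeasureTheory Metric Real Filter
open scoped BigOperators ENNReal NNReal RealInnerProductSpace Topology

noncomputable section

/-- The unit sphere `S^N` as a subtype of `ℝ^{N+1}` (with the Euclidean structure). -/
abbrev Sph (N : ℕ) : Type := Metric.sphere (0 : EuclideanSpace ℝ (Fin (N + 1))) 1

/-- The surface measure `σ` on the sphere `S^N`. -/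
def sphMeasure (N : ℕ) : Measure (Sph N) :=
  (volume : Measure (EuclideanSpace ℝ (Fin (N + 1)))).toSphere

/-- The spherical (geodesic) distance `γ(x,y) ∈ [0,π]` between two points of `S^N`. -/
def geoDist {N : ℕ} (x y : Sph N) : ℝ :=
  Real.arccos ⟪(x : EuclideanSpace ℝ (Fin (N + 1))), (y : EuclideanSpace ℝ (Fin (N + 1)))⟫

/-- The spherical ball `B(x,r) = {y : γ(x,y) ≤ r}`. -/
def sphBall {N : ℕ} (x : Sph N) (r : ℝ) : Set (Sph N) := {y | geoDist x y ≤ r}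

/-- The point of the sphere diametrically opposite to `x`. -/
def antipode {N : ℕ} (x : Sph N) : Sph N :=
  ⟨-(x : EuclideanSpace ℝ (Fin (N + 1))), by
    have hx := x.2
    simp only [mem_sphere_iff_norm, sub_zero, norm_neg] at hx ⊢
    exact hx⟩

/-- A spherical harmonic of degree `k` on `S^N`: the restriction to the sphere of a
homogeneous polynomial of degree `k` on `ℝ^{N+1}` annihilated by the Euclidean Laplacian
(equivalently, an eigenfunction of the Laplace–Beltrami operator `−Δ_s` with
eigenvalue `k(k+N−1)`). -/
def IsSphericalHarmonic (N k : ℕ) (g : Sph N → ℝ) : Prop :=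
  ∃ P : MvPolynomial (Fin (N + 1)) ℝ,
    P.IsHomogeneous k ∧
    (∑ i, MvPolynomial.pderiv i (MvPolynomial.pderiv i P)) = 0 ∧
    ∀ x : Sph N, g x = MvPolynomial.eval (fun i => (x : EuclideanSpace ℝ (Fin (N + 1))) i) P

/-- `Y k j`, `j < a k`, is for each `k` an orthonormal basis (w.r.t. `L²(S^N, σ)`)
of the space `ℵ_k` of spherical harmonics of degree `k`. -/
structure IsFourierLaplaceBasis (N : ℕ) (a : ℕ → ℕ) (Y : (k : ℕ) → Fin (a k) → Sph N → ℝ) :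
    Prop where
  harmonic : ∀ k j, IsSphericalHarmonic N k (Y k j)
  orthonormal : ∀ k, ∀ j j' : Fin (a k),
    ∫ x, Y k j x * Y k j' x ∂(sphMeasure N) = if j = j' then 1 else 0
  spanning : ∀ k (g : Sph N → ℝ), IsSphericalHarmonic N k g →
    g ∈ Submodule.span ℝ (Set.range (Y k))

/-- The Cesàro number `A_m^α = Γ(α+m+1)/(Γ(α+1) m!)`. -/
def cesaroA (α : ℝ) (m : ℕ) : ℝ :=
  Real.Gamma (α + m + 1) / (Real.Gamma (α + 1) * (Nat.factorial m))

/-- The Fourier–Laplace coefficient `f_{k,j} = ∫_{S^N} f(y) Y_j^k(y) dσ(y)`. -/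
def flCoeff {N : ℕ} {a : ℕ → ℕ} (Y : (k : ℕ) → Fin (a k) → Sph N → ℝ) (f : Sph N → ℝ)
    (k : ℕ) (j : Fin (a k)) : ℝ :=
  ∫ y, f y * Y k j y ∂(sphMeasure N)

/-- The Cesàro mean of order `α` of the Fourier–Laplace series of `f`:
`S_n^α f(x) = (1/A_n^α) Σ_{k=0}^n A_{n−k}^α Σ_{j=1}^{a_k} f_{k,j} Y_j^k(x)`. -/
def cesaroMean {N : ℕ} {a : ℕ → ℕ} (Y : (k : ℕ) → Fin (a k) → Sph N → ℝ) (α : ℝ)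
    (f : Sph N → ℝ) (n : ℕ) (x : Sph N) : ℝ :=
  (cesaroA α n)⁻¹ *
    ∑ k ∈ Finset.range (n + 1), cesaroA α (n - k) * ∑ j, flCoeff Y f k j * Y k j x

/-- The maximal operator `S_*^α f(x) = sup_{n ≥ 1} |S_n^α f(x)|` (with values in `ℝ≥0∞`). -/
def cesaroMaximal {N : ℕ} {a : ℕ → ℕ} (Y : (k : ℕ) → Fin (a k) → Sph N → ℝ) (α : ℝ)
    (f : Sph N → ℝ) (x : Sph N) : ℝ≥0∞ :=
  ⨆ (n : ℕ) (_ : 1 ≤ n), ENNReal.ofReal |cesaroMean Y α f n x|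

/-- The Hardy–Littlewood maximal function
`f*(x) = sup_{r>0} (1/σ(B(x,r))) ∫_{B(x,r)} |f| dσ` (with values in `ℝ≥0∞`). -/
def hlMaximal {N : ℕ} (f : Sph N → ℝ) (x : Sph N) : ℝ≥0∞ :=
  ⨆ (r : ℝ) (_ : 0 < r),
    (sphMeasure N (sphBall x r))⁻¹ * ∫⁻ y in sphBall x r, ENNReal.ofReal |f y| ∂(sphMeasure N)

/-- The Cesàro means of order `α` of the spectral function:
`Θ^α(x,y,n) = (1/A_n^α) Σ_{k=0}^n A_{n−k}^α Σ_{j=1}^{a_k} Y_j^k(x) Y_j^k(y)`. -/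
def cesaroKernel {N : ℕ} {a : ℕ → ℕ} (Y : (k : ℕ) → Fin (a k) → Sph N → ℝ) (α : ℝ)
    (n : ℕ) (x y : Sph N) : ℝ :=
  (cesaroA α n)⁻¹ *
    ∑ k ∈ Finset.range (n + 1), cesaroA α (n - k) * ∑ j, Y k j x * Y k j y

/-! ### Polar coordinates on `ℝ^{N+1}` -/

instance sphMeasure.instIsFiniteMeasure (N : ℕ) : IsFiniteMeasure (sphMeasure N) := by
  unfold sphMeasure; infer_instance

/-- Integration of a nonnegative function in polar coordinates. -/
theorem lintegral_polar (N : ℕ) (F : EuclideanSpace ℝ (Fin (N + 1)) → ℝ≥0∞) (hF : Measurable F) :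
    ∫⁻ x, F x = ∫⁻ y : Sph N, (∫⁻ r in Set.Ioi (0 : ℝ),
      ENNReal.ofReal (r ^ N) * F (r • (y : EuclideanSpace ℝ (Fin (N + 1))))) ∂(sphMeasure N) := by
  have hmp := (volume : Measure (EuclideanSpace ℝ
    (Fin (N + 1)))).measurePreserving_homeomorphUnitSphereProd
  have h1 := hmp.lintegral_comp_emb (Homeomorph.measurableEmbedding _)
    (fun p => F (p.2.1 • (p.1 : EuclideanSpace ℝ (Fin (N + 1)))))
  have h2 : ∀ x : ({0}ᶜ : Set (EuclideanSpace ℝ (Fin (N + 1)))),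
      F (((homeomorphUnitSphereProd _ x).2 : ℝ) •
        ((homeomorphUnitSphereProd _ x).1 : EuclideanSpace ℝ (Fin (N + 1)))) = F x := by
    intro x
    have hx : ‖(x : EuclideanSpace ℝ (Fin (N + 1)))‖ ≠ 0 := norm_ne_zero_iff.2 x.2
    simp [smul_smul, hx]
  simp only [h2] at h1
  rw [lintegral_subtype_comap (measurableSet_singleton _).compl, restrict_compl_singleton] at h1
  rw [h1, lintegral_prod _ (by fun_prop)]
  refine lintegral_congr fun y => ?_
  rw [finrank_euclideanSpace, Fintype.card_fin, Nat.add_sub_cancel, Measure.volumeIoiPow,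
    lintegral_withDensity_eq_lintegral_mul _ (by fun_prop) (by fun_prop)]
  exact lintegral_subtype_comap measurableSet_Ioi
    (fun r : ℝ => ENNReal.ofReal (r ^ N) * F (r • (y : EuclideanSpace ℝ (Fin (N + 1)))))

/-- The integral of a product of a homogeneous function and a radial function. -/
theorem integral_homogeneous_mul_radial (N d : ℕ) (F : EuclideanSpace ℝ (Fin (N + 1)) → ℝ)
    (hF : ∀ (r : ℝ) x, F (r • x) = r ^ d * F x) (φ : ℝ → ℝ) :
    ∫ x, F x * φ ‖x‖ =
      (∫ y : Sph N, F y ∂(sphMeasure N)) * ∫ r in Set.Ioi (0 : ℝ), r ^ (N + d) * φ r := by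
  have hmp := (volume : Measure (EuclideanSpace ℝ
    (Fin (N + 1)))).measurePreserving_homeomorphUnitSphereProd
  have h1 := hmp.integral_comp (Homeomorph.measurableEmbedding _)
    (fun p => F (p.1 : EuclideanSpace ℝ (Fin (N + 1))) * ((p.2.1) ^ d * φ p.2.1))
  have h2 : ∀ x : ({0}ᶜ : Set (EuclideanSpace ℝ (Fin (N + 1)))),
      F ((homeomorphUnitSphereProd _ x).1 : EuclideanSpace ℝ (Fin (N + 1))) *
        (((homeomorphUnitSphereProd _ x).2 : ℝ) ^ d * φ ((homeomorphUnitSphereProd _ x).2 : ℝ))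
        = F x * φ ‖(x : EuclideanSpace ℝ (Fin (N + 1)))‖ := by
    intro x
    have hx : ‖(x : EuclideanSpace ℝ (Fin (N + 1)))‖ ≠ 0 := norm_ne_zero_iff.2 x.2
    rw [← mul_assoc, mul_comm (F _), ← hF]
    simp [smul_smul, hx]
  simp only [h2] at h1
  rw [integral_subtype_comap (measurableSet_singleton _).compl
    (fun x => F x * φ ‖(x : EuclideanSpace ℝ (Fin (N + 1)))‖), restrict_compl_singleton] at h1
  rw [h1, integral_prod_mul (fun y : Sph N => F y)
    (fun r : Set.Ioi (0 : ℝ) => r.1 ^ d * φ r.1)]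
  congr 1
  rw [finrank_euclideanSpace, Fintype.card_fin, Nat.add_sub_cancel, Measure.volumeIoiPow,
    integral_withDensity_eq_integral_toReal_smul (by fun_prop) (by simp)]
  rw [← integral_subtype_comap measurableSet_Ioi (fun r => r ^ (N + d) * φ r)]
  refine integral_congr_ae (.of_forall fun r => ?_)
  have : 0 < r.1 := r.2
  simp only [smul_eq_mul]
  rw [ENNReal.toReal_ofReal (by positivity)]
  ring

theorem integrable_homogeneous_mul_gaussian (N d : ℕ) (F : EuclideanSpace ℝ (Fin (N + 1)) → ℝ)
    (hF : ∀ (r : ℝ) x, F (r • x) = r ^ d * F x) (hc : Continuous F) :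
    Integrable (fun x => F x * rexp (-‖x‖ ^ 2)) := by
  have hmp := (volume : Measure (EuclideanSpace ℝ
    (Fin (N + 1)))).measurePreserving_homeomorphUnitSphereProd
  have h1 := hmp.integrable_comp_emb (Homeomorph.measurableEmbedding _)
    (g := fun p => F (p.1 : EuclideanSpace ℝ (Fin (N + 1))) *
      ((p.2.1) ^ d * rexp (-p.2.1 ^ 2)))
  have h2 : ∀ x : ({0}ᶜ : Set (EuclideanSpace ℝ (Fin (N + 1)))),
      F ((homeomorphUnitSphereProd _ x).1 : EuclideanSpace ℝ (Fin (N + 1))) *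
        (((homeomorphUnitSphereProd _ x).2 : ℝ) ^ d *
          rexp (-((homeomorphUnitSphereProd _ x).2 : ℝ) ^ 2))
        = F x * rexp (-‖(x : EuclideanSpace ℝ (Fin (N + 1)))‖ ^ 2) := by
    intro x
    have hx : ‖(x : EuclideanSpace ℝ (Fin (N + 1)))‖ ≠ 0 := norm_ne_zero_iff.2 x.2
    rw [← mul_assoc, mul_comm (F _), ← hF]
    simp [smul_smul, hx]
  simp only [Function.comp_def, h2] at h1
  rw [← restrict_compl_singleton (μ := volume) (0 : EuclideanSpace ℝ (Fin (N + 1))),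
    ← IntegrableOn, integrableOn_iff_comap_subtypeVal (measurableSet_singleton _).compl,
    Function.comp_def, h1]
  have hG : Integrable (fun r : Set.Ioi (0 : ℝ) => r.1 ^ d * rexp (-r.1 ^ 2))
      (Measure.volumeIoiPow N) := by
    rw [Measure.volumeIoiPow, integrable_withDensity_iff_integrable_smul' (by fun_prop) (by simp)]
    have h3 : IntegrableOn (fun r : ℝ => r ^ ((N : ℝ) + d) * rexp (-r ^ (2 : ℝ))) (Set.Ioi 0) :=
      integrableOn_rpow_mul_exp_neg_rpow
        (lt_of_lt_of_le (by norm_num) (by positivity : (0 : ℝ) ≤ N + d)) (by norm_num)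
    rw [integrableOn_iff_comap_subtypeVal measurableSet_Ioi] at h3
    refine h3.congr (.of_forall fun r => ?_)
    have : 0 < r.1 := r.2
    simp only [smul_eq_mul, Function.comp]
    rw [ENNReal.toReal_ofReal (by positivity), Real.rpow_two, ← Nat.cast_add, Real.rpow_natCast]
    ring
  have hF' : Integrable (fun y : Sph N => F y) (sphMeasure N) :=
    (hc.comp continuous_subtype_val).integrable_of_hasCompactSupport
      (HasCompactSupport.of_compactSpace _)
  rw [finrank_euclideanSpace, Fintype.card_fin, Nat.add_sub_cancel]
  exact hF'.mul_prod hG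
/-! ### Integration by parts for polynomials on the sphere -/

/-- Evaluation of a polynomial at a point of Euclidean space. -/
def polyEval {N : ℕ} (P : MvPolynomial (Fin (N + 1)) ℝ) (x : EuclideanSpace ℝ (Fin (N + 1))) : ℝ :=
  MvPolynomial.eval (fun i => x i) P

/-- The derivative of a polynomial in the direction `v`. -/
def dirDeriv {N : ℕ} (v : EuclideanSpace ℝ (Fin (N + 1))) :
    Derivation ℝ (MvPolynomial (Fin (N + 1)) ℝ) (MvPolynomial (Fin (N + 1)) ℝ) :=
  MvPolynomial.mkDerivation ℝ (fun i => MvPolynomial.C (v i))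

/-- The linear form `x ↦ ⟪v, x⟫` as a polynomial. -/
def linForm {N : ℕ} (v : EuclideanSpace ℝ (Fin (N + 1))) : MvPolynomial (Fin (N + 1)) ℝ :=
  ∑ i, MvPolynomial.C (v i) * MvPolynomial.X i

/-- The quadratic form `x ↦ ‖x‖ ^ 2` as a polynomial. -/
def normSqPoly (N : ℕ) : MvPolynomial (Fin (N + 1)) ℝ := ∑ i, MvPolynomial.X i ^ 2

/-- The Euclidean Laplacian of a polynomial. -/
def polyLaplacian {N : ℕ} (P : MvPolynomial (Fin (N + 1)) ℝ) : MvPolynomial (Fin (N + 1)) ℝ :=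
  ∑ i, MvPolynomial.pderiv i (MvPolynomial.pderiv i P)

theorem polyEval_mul {N : ℕ} (P Q : MvPolynomial (Fin (N + 1)) ℝ)
    (x : EuclideanSpace ℝ (Fin (N + 1))) : polyEval (P * Q) x = polyEval P x * polyEval Q x := by
  simp [polyEval]

theorem polyEval_linForm {N : ℕ} (v x : EuclideanSpace ℝ (Fin (N + 1))) :
    polyEval (linForm v) x = ⟪x, v⟫ := by
  simp [polyEval, linForm, PiLp.inner_apply]

theorem polyEval_normSqPoly {N : ℕ} (x : EuclideanSpace ℝ (Fin (N + 1))) :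
    polyEval (normSqPoly N) x = ‖x‖ ^ 2 := by
  simp [polyEval, normSqPoly, EuclideanSpace.norm_sq_eq]

theorem continuous_polyEval {N : ℕ} (P : MvPolynomial (Fin (N + 1)) ℝ) :
    Continuous (polyEval P) := by
  unfold polyEval
  exact (MvPolynomial.continuous_eval P).comp (PiLp.continuous_ofLp 2 _)

theorem integrable_polyEval {N : ℕ} (P : MvPolynomial (Fin (N + 1)) ℝ) :
    Integrable (fun x : Sph N => polyEval P x) (sphMeasure N) :=
  ((continuous_polyEval P).comp continuous_subtype_val).integrable_of_hasCompactSupport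
    (HasCompactSupport.of_compactSpace _)

theorem polyEval_smul_of_isHomogeneous {N d : ℕ} {P : MvPolynomial (Fin (N + 1)) ℝ}
    (hP : P.IsHomogeneous d) (r : ℝ) (x : EuclideanSpace ℝ (Fin (N + 1))) :
    polyEval P (r • x) = r ^ d * polyEval P x := by
  simp only [polyEval, MvPolynomial.eval_eq', Finset.mul_sum]
  refine Finset.sum_congr rfl fun s hs => ?_
  have hd : s.degree = d := by
    by_contra h
    exact MvPolynomial.mem_support_iff.1 hs (hP.coeff_eq_zero h)
  simp only [PiLp.smul_apply, smul_eq_mul, mul_pow, Finset.prod_mul_distrib,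
    Finset.prod_pow_eq_pow_sum]
  rw [← hd, Finsupp.degree_eq_sum]
  ring

theorem dirDeriv_eq_sum {N : ℕ} (v : EuclideanSpace ℝ (Fin (N + 1)))
    (P : MvPolynomial (Fin (N + 1)) ℝ) :
    dirDeriv v P = ∑ i, MvPolynomial.C (v i) * MvPolynomial.pderiv i P := by
  induction P using MvPolynomial.induction_on with
  | C a => simp [dirDeriv]
  | add p q hp hq => simp [hp, hq, mul_add, Finset.sum_add_distrib]
  | mul_X p i hp =>
    have hX : dirDeriv v (MvPolynomial.X i) = MvPolynomial.C (v i) := by simp [dirDeriv]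
    have hs : ∑ j, MvPolynomial.C (v j) * (p * MvPolynomial.pderiv j (MvPolynomial.X i)) =
        p * MvPolynomial.C (v i) := by
      rw [Finset.sum_eq_single i]
      · rw [MvPolynomial.pderiv_X_self]; ring
      · intro j _ hj
        rw [MvPolynomial.pderiv_X_of_ne hj.symm]; ring
      · simp
    rw [Derivation.leibniz, hp, hX, smul_eq_mul, smul_eq_mul, ← hs, Finset.mul_sum,
      ← Finset.sum_add_distrib]
    refine Finset.sum_congr rfl fun j _ => ?_
    rw [Derivation.leibniz, smul_eq_mul, smul_eq_mul]
    ring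

theorem isHomogeneous_dirDeriv {N d : ℕ} (v : EuclideanSpace ℝ (Fin (N + 1)))
    {P : MvPolynomial (Fin (N + 1)) ℝ} (hP : P.IsHomogeneous d) :
    (dirDeriv v P).IsHomogeneous (d - 1) := by
  rw [dirDeriv_eq_sum]
  refine MvPolynomial.IsHomogeneous.sum _ _ _ fun i _ => ?_
  simpa using (MvPolynomial.isHomogeneous_C _ (v i)).mul (hP.pderiv (i := i))

theorem isHomogeneous_linForm {N : ℕ} (v : EuclideanSpace ℝ (Fin (N + 1))) :
    (linForm v).IsHomogeneous 1 := by
  refine MvPolynomial.IsHomogeneous.sum _ _ _ fun i _ => ?_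
  simpa using (MvPolynomial.isHomogeneous_C _ (v i)).mul (MvPolynomial.isHomogeneous_X ℝ i)

theorem isHomogeneous_normSqPoly (N : ℕ) : (normSqPoly N).IsHomogeneous 2 := by
  refine MvPolynomial.IsHomogeneous.sum _ _ _ fun i _ => ?_
  simpa using (MvPolynomial.isHomogeneous_X ℝ i).pow 2

theorem hasLineDerivAt_polyEval {N : ℕ} (P : MvPolynomial (Fin (N + 1)) ℝ)
    (x v : EuclideanSpace ℝ (Fin (N + 1))) :
    HasLineDerivAt ℝ (polyEval P) (polyEval (dirDeriv v P) x) x v := by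
  unfold HasLineDerivAt
  induction P using MvPolynomial.induction_on with
  | C a => simpa [polyEval] using hasDerivAt_const (0 : ℝ) a
  | add p q hp hq => simpa [polyEval, Pi.add_def] using hp.add hq
  | mul_X p i hp =>
    have h1 : HasDerivAt (fun t : ℝ => x i + t * v i) (v i) 0 := by
      simpa using ((hasDerivAt_id (0 : ℝ)).mul_const (v i)).const_add (x i)
    have h2 := hp.mul h1
    simp only [polyEval, dirDeriv, Derivation.leibniz, MvPolynomial.mkDerivation_X, map_add,
      smul_eq_mul, map_mul, MvPolynomial.eval_X, MvPolynomial.eval_C] at h2 ⊢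
    simp only [PiLp.add_apply, PiLp.smul_apply, smul_eq_mul, zero_smul, add_zero,
      zero_mul] at h2 ⊢
    exact h2.congr_deriv (by ring)

/-- Integration by parts against the Gaussian. -/
theorem integral_linForm_mul_gaussian {N d : ℕ} (v : EuclideanSpace ℝ (Fin (N + 1)))
    {P : MvPolynomial (Fin (N + 1)) ℝ} (hP : P.IsHomogeneous d) :
    2 * ∫ x, polyEval (linForm v * P) x * rexp (-‖x‖ ^ 2) =
      ∫ x, polyEval (dirDeriv v P) x * rexp (-‖x‖ ^ 2) := by
  have hint : ∀ {e : ℕ} {Q : MvPolynomial (Fin (N + 1)) ℝ}, Q.IsHomogeneous e →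
      Integrable (fun x => polyEval Q x * rexp (-‖x‖ ^ 2)) := fun hQ =>
    integrable_homogeneous_mul_gaussian N _ _ (polyEval_smul_of_isHomogeneous hQ)
      (continuous_polyEval _)
  have hg : ∀ x : EuclideanSpace ℝ (Fin (N + 1)),
      HasLineDerivAt ℝ (fun x => rexp (-‖x‖ ^ 2)) (-2 * ⟪x, v⟫ * rexp (-‖x‖ ^ 2)) x v := by
    intro x
    have h1 : HasDerivAt (fun t : ℝ => x + t • v) v 0 := by
      simpa using ((hasDerivAt_id (0 : ℝ)).smul_const v).const_add x
    have h2 := (h1.norm_sq.neg).exp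
    unfold HasLineDerivAt
    refine h2.congr_deriv ?_
    simp only [Pi.neg_apply, zero_smul, add_zero]
    ring
  have key := integral_bilinear_hasLineDerivAt_right_eq_neg_left_of_integrable
    (μ := (volume : Measure (EuclideanSpace ℝ (Fin (N + 1)))))
    (f := polyEval P) (f' := polyEval (dirDeriv v P)) (g := fun x => rexp (-‖x‖ ^ 2))
    (g' := fun x => -2 * ⟪x, v⟫ * rexp (-‖x‖ ^ 2)) (v := v) (B := ContinuousLinearMap.mul ℝ ℝ)
    (hint (isHomogeneous_dirDeriv v hP))
    (by
      refine ((hint ((isHomogeneous_linForm v).mul hP)).const_mul (-2)).congr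
        (.of_forall fun x => ?_)
      simp only [polyEval_mul, polyEval_linForm, ContinuousLinearMap.mul_apply']
      ring)
    (hint hP) (fun x _ => hasLineDerivAt_polyEval P x v) (fun x _ => hg x)
  simp only [ContinuousLinearMap.mul_apply'] at key
  rw [← neg_eq_iff_eq_neg] at key
  rw [← key, ← integral_neg, ← integral_const_mul]
  refine integral_congr_ae (.of_forall fun x => ?_)
  simp only [polyEval_mul, polyEval_linForm]
  ring

theorem integral_pow_mul_gaussian_succ (m : ℕ) :
    2 * ∫ r in Set.Ioi (0 : ℝ), r ^ (m + 2) * rexp (-r ^ 2) =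
      (m + 1) * ∫ r in Set.Ioi (0 : ℝ), r ^ m * rexp (-r ^ 2) := by
  have h : ∀ k : ℕ, ∫ r in Set.Ioi (0 : ℝ), r ^ k * rexp (-r ^ 2) =
      1 / 2 * Real.Gamma ((k + 1) / 2) := by
    intro k
    rw [← integral_rpow_mul_exp_neg_rpow (p := 2) (q := k) (by norm_num)
      (lt_of_lt_of_le (by norm_num) (by positivity : (0 : ℝ) ≤ k))]
    simp
  rw [h, h]
  have : (((m + 2 : ℕ) : ℝ) + 1) / 2 = (m + 1) / 2 + 1 := by push_cast; ring
  rw [this, Real.Gamma_add_one (by positivity)]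
  ring

theorem integral_pow_mul_gaussian_pos (m : ℕ) :
    0 < ∫ r in Set.Ioi (0 : ℝ), r ^ m * rexp (-r ^ 2) := by
  have := integral_rpow_mul_exp_neg_rpow (p := 2) (q := m) (by norm_num)
      (lt_of_lt_of_le (by norm_num) (by positivity : (0 : ℝ) ≤ m))
  simp only [Real.rpow_two, Real.rpow_natCast] at this
  rw [this]
  have := Real.Gamma_pos_of_pos (by positivity : (0 : ℝ) < (m + 1) / 2)
  positivity

/-- Integration by parts on the sphere: for `P` homogeneous of degree `d`,
`(N + d) ∫ ⟪x, v⟫ P = ∫ ∂_v P`. -/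
theorem integral_sphere_linForm_mul {N d : ℕ} (v : EuclideanSpace ℝ (Fin (N + 1)))
    {P : MvPolynomial (Fin (N + 1)) ℝ} (hP : P.IsHomogeneous d) :
    ((N : ℝ) + d) * ∫ x : Sph N, polyEval (linForm v * P) x ∂(sphMeasure N) =
      ∫ x : Sph N, polyEval (dirDeriv v P) x ∂(sphMeasure N) := by
  have key := integral_linForm_mul_gaussian v hP
  rw [integral_homogeneous_mul_radial N _ _
      (polyEval_smul_of_isHomogeneous ((isHomogeneous_linForm v).mul hP)) (fun r => rexp (-r ^ 2)),
    integral_homogeneous_mul_radial N _ _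
      (polyEval_smul_of_isHomogeneous (isHomogeneous_dirDeriv v hP)) (fun r => rexp (-r ^ 2))]
    at key
  rcases d with _ | d
  · have hz : dirDeriv v P = 0 := by
      obtain ⟨c, rfl⟩ : ∃ c, P = MvPolynomial.C c :=
        ⟨_, MvPolynomial.totalDegree_eq_zero_iff_eq_C.1 (Nat.le_zero.1 hP.totalDegree_le)⟩
      simp [dirDeriv]
    have h0 := (integral_pow_mul_gaussian_pos (N + (1 + 0))).ne'
    simp only [hz, polyEval, map_zero, integral_zero, zero_mul] at key ⊢
    simp only [mul_eq_zero, h0, or_false, OfNat.ofNat_ne_zero, false_or] at key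
    rw [key, mul_zero]
  · have h1 : N + (1 + (d + 1)) = N + d + 2 := by ring
    have h0 := (integral_pow_mul_gaussian_pos (N + d)).ne'
    rw [h1, Nat.add_sub_cancel] at key
    apply mul_right_cancel₀ h0
    rw [← key, mul_left_comm, integral_pow_mul_gaussian_succ]
    push_cast
    ring
/-! ### Gegenbauer polynomials and the zonal reproducing kernel -/

/-- The Gegenbauer polynomials `C_k^l(t)`. -/
def gegenbauer (l t : ℝ) : ℕ → ℝ
  | 0 => 1
  | 1 => 2 * l * t
  | k + 2 => 2 * (k + 1 + l) / (k + 2) * t * gegenbauer l t (k + 1) -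
      (k + 2 * l) / (k + 2) * gegenbauer l t k

/-- The homogeneous polynomial whose restriction to the sphere is `x ↦ C_k^l(⟪x, y⟫)`. -/
def zonalPoly {N : ℕ} (l : ℝ) (y : EuclideanSpace ℝ (Fin (N + 1))) :
    ℕ → MvPolynomial (Fin (N + 1)) ℝ
  | 0 => 1
  | 1 => MvPolynomial.C (2 * l) * linForm y
  | k + 2 => MvPolynomial.C (2 * (k + 1 + l) / (k + 2)) * (linForm y * zonalPoly l y (k + 1)) -
      MvPolynomial.C ((k + 2 * l) / (k + 2)) * (normSqPoly N * zonalPoly l y k)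

theorem polyEval_zonalPoly {N : ℕ} (l : ℝ) (y x : EuclideanSpace ℝ (Fin (N + 1)))
    (hx : ‖x‖ = 1) (k : ℕ) : polyEval (zonalPoly l y k) x = gegenbauer l ⟪x, y⟫ k := by
  have hp := polyEval_linForm y x
  have hq := polyEval_normSqPoly x
  rw [hx] at hq
  induction k using Nat.twoStepInduction with
  | zero => simp [polyEval, zonalPoly, gegenbauer]
  | one =>
    rw [zonalPoly, polyEval_mul, hp, gegenbauer]
    simp [polyEval]
  | more k h0 h1 =>
    have hsub : ∀ P Q : MvPolynomial (Fin (N + 1)) ℝ,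
        polyEval (P - Q) x = polyEval P x - polyEval Q x := fun P Q => by simp [polyEval]
    have hC : ∀ c : ℝ, polyEval (MvPolynomial.C c) x = c := fun c => by simp [polyEval]
    rw [zonalPoly, gegenbauer, hsub, polyEval_mul, polyEval_mul, polyEval_mul, polyEval_mul, hp, hq,
      h0, h1, hC, hC]
    ring

theorem zonalPoly_recurrence {N : ℕ} (l : ℝ) (y : EuclideanSpace ℝ (Fin (N + 1))) (k : ℕ) :
    ((k : MvPolynomial (Fin (N + 1)) ℝ) + 2) * zonalPoly l y (k + 2) =
      2 * ((k : MvPolynomial (Fin (N + 1)) ℝ) + 1 + MvPolynomial.C l) *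
        (linForm y * zonalPoly l y (k + 1)) -
        ((k : MvPolynomial (Fin (N + 1)) ℝ) + 2 * MvPolynomial.C l) *
          (normSqPoly N * zonalPoly l y k) := by
  have hk : ((k : ℝ) + 2) ≠ 0 := by positivity
  have e : ∀ c : ℝ, ((k : MvPolynomial (Fin (N + 1)) ℝ) + 2) * MvPolynomial.C (c / (k + 2)) =
      MvPolynomial.C c := by
    intro c
    have : ((k : MvPolynomial (Fin (N + 1)) ℝ) + 2) = MvPolynomial.C ((k : ℝ) + 2) := by
      rw [map_add, map_natCast, map_ofNat]
    rw [this, ← MvPolynomial.C_mul, mul_div_cancel₀ _ hk]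
  have e1 := e (2 * (k + 1 + l))
  have e2 := e (k + 2 * l)
  simp only [map_add, map_mul, map_natCast, map_one, map_ofNat] at e1 e2
  rw [zonalPoly]
  linear_combination (linForm y * zonalPoly l y (k + 1)) * e1 -
    (normSqPoly N * zonalPoly l y k) * e2

theorem isHomogeneous_zonalPoly {N : ℕ} (l : ℝ) (y : EuclideanSpace ℝ (Fin (N + 1))) (k : ℕ) :
    (zonalPoly l y k).IsHomogeneous k := by
  induction k using Nat.twoStepInduction with
  | zero => exact MvPolynomial.isHomogeneous_one _ _
  | one =>
    have := (MvPolynomial.isHomogeneous_C (Fin (N + 1)) (2 * l)).mul (isHomogeneous_linForm y)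
    rw [zonalPoly]
    rwa [zero_add] at this
  | more k h0 h1 =>
    rw [zonalPoly]
    have e1 := (MvPolynomial.isHomogeneous_C (Fin (N + 1)) (2 * (k + 1 + l) / (k + 2) : ℝ)).mul
      ((isHomogeneous_linForm y).mul h1)
    have e2 := (MvPolynomial.isHomogeneous_C (Fin (N + 1)) ((k + 2 * l) / (k + 2) : ℝ)).mul
      ((isHomogeneous_normSqPoly N).mul h0)
    rw [show 0 + (1 + (k + 1)) = k + 2 by ring] at e1
    rw [show 0 + (2 + k) = k + 2 by ring] at e2
    exact e1.sub e2

theorem dirDeriv_linForm_self {N : ℕ} {y : EuclideanSpace ℝ (Fin (N + 1))} (hy : ‖y‖ = 1) :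
    dirDeriv y (linForm y) = 1 := by
  have h : ∑ i, y i * y i = 1 := by
    have := EuclideanSpace.norm_sq_eq y
    rw [hy] at this
    simp only [Real.norm_eq_abs, sq_abs, one_pow] at this
    rw [this]
    exact Finset.sum_congr rfl fun i _ => by ring
  have hX : ∀ i, dirDeriv y (MvPolynomial.X i) = MvPolynomial.C (y i) := fun i => by
    simp [dirDeriv]
  have hC : ∀ c, dirDeriv y (MvPolynomial.C c) = 0 := fun c => by simp [dirDeriv]
  simp only [linForm, map_sum, Derivation.leibniz, hX, hC, smul_eq_mul, mul_zero, add_zero]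
  simp only [← MvPolynomial.C_mul, ← map_sum, h, map_one]

theorem dirDeriv_normSqPoly {N : ℕ} (y : EuclideanSpace ℝ (Fin (N + 1))) :
    dirDeriv y (normSqPoly N) = 2 * linForm y := by
  have hX : ∀ i, dirDeriv y (MvPolynomial.X i) = MvPolynomial.C (y i) := fun i => by
    simp [dirDeriv]
  simp only [normSqPoly, linForm, map_sum, Derivation.leibniz_pow, hX, Finset.mul_sum]
  refine Finset.sum_congr rfl fun i _ => ?_
  simp
  ring

theorem dirDeriv_natCast {N : ℕ} (y : EuclideanSpace ℝ (Fin (N + 1))) (k : ℕ) :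
    dirDeriv y (k : MvPolynomial (Fin (N + 1)) ℝ) = 0 := by
  simp

theorem dirDeriv_zonalPoly {N : ℕ} (l : ℝ) {y : EuclideanSpace ℝ (Fin (N + 1))} (hy : ‖y‖ = 1)
    (k : ℕ) : dirDeriv y (zonalPoly l y (k + 1)) =
      ((k : MvPolynomial (Fin (N + 1)) ℝ) + 2 * MvPolynomial.C l) * zonalPoly l y k := by
  have hp := dirDeriv_linForm_self hy
  have hq := dirDeriv_normSqPoly y
  have hC : ∀ c, dirDeriv y (MvPolynomial.C c) = 0 := fun c => by simp [dirDeriv]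
  have hne : ∀ n : ℕ, ((n : MvPolynomial (Fin (N + 1)) ℝ) + 2) ≠ 0 := fun n => by
    exact_mod_cast (by omega : n + 2 ≠ 0)
  have hrec : ∀ k : ℕ, ((k : MvPolynomial (Fin (N + 1)) ℝ) + 2) *
      dirDeriv y (zonalPoly l y (k + 2)) =
      2 * ((k : MvPolynomial (Fin (N + 1)) ℝ) + 1 + MvPolynomial.C l) *
        (zonalPoly l y (k + 1) + linForm y * dirDeriv y (zonalPoly l y (k + 1))) -
      ((k : MvPolynomial (Fin (N + 1)) ℝ) + 2 * MvPolynomial.C l) *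
        (2 * linForm y * zonalPoly l y k + normSqPoly N * dirDeriv y (zonalPoly l y k)) := by
    intro k
    have hk : dirDeriv y ((k : MvPolynomial (Fin (N + 1)) ℝ) + 2) = 0 := by
      have := dirDeriv_natCast y (k + 2)
      push_cast at this
      exact this
    have hk1 : dirDeriv y (2 * ((k : MvPolynomial (Fin (N + 1)) ℝ) + 1 + MvPolynomial.C l)) =
        0 := by
      have := hC (2 * (k + 1 + l))
      simpa only [map_add, map_mul, map_natCast, map_one, map_ofNat] using this
    have hk2 : dirDeriv y ((k : MvPolynomial (Fin (N + 1)) ℝ) + 2 * MvPolynomial.C l) = 0 := by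
      have := hC (k + 2 * l)
      simpa only [map_add, map_mul, map_natCast, map_one, map_ofNat] using this
    have := congrArg (dirDeriv y) (zonalPoly_recurrence l y k)
    rw [map_sub] at this
    simp only [Derivation.leibniz, hk, hk1, hk2, hp, hq, smul_eq_mul] at this
    linear_combination this
  induction k using Nat.twoStepInduction with
  | zero =>
    have z1 : zonalPoly l y (0 + 1) = MvPolynomial.C (2 * l) * linForm y := by
      rw [zero_add, zonalPoly]
    rw [z1, Derivation.leibniz, hp, hC, zonalPoly, smul_eq_mul, smul_eq_mul, map_mul, map_ofNat]
    push_cast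
    ring
  | one =>
    have h2 := hrec 0
    have z1 : zonalPoly l y 1 = MvPolynomial.C (2 * l) * linForm y := by rw [zonalPoly]
    have z0 : zonalPoly l y 0 = 1 := by rw [zonalPoly]
    have d1 : dirDeriv y (zonalPoly l y 1) = MvPolynomial.C (2 * l) := by
      rw [z1, Derivation.leibniz, hp, hC]; simp
    apply mul_left_cancel₀ (hne 0)
    rw [h2, d1, z0, z1, map_mul, map_ofNat, Derivation.map_one_eq_zero]
    push_cast
    ring
  | more k h0 h1 =>
    apply mul_left_cancel₀ (hne (k + 1))
    rw [hrec, h1, h0]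
    have := zonalPoly_recurrence l y k
    push_cast at this ⊢
    linear_combination (-1) * ((k : MvPolynomial (Fin (N + 1)) ℝ) + 1 + 2 * MvPolynomial.C l) * this

theorem polyLaplacian_mul {N : ℕ} (P Q : MvPolynomial (Fin (N + 1)) ℝ) :
    polyLaplacian (P * Q) = polyLaplacian P * Q +
      2 * ∑ i, MvPolynomial.pderiv i P * MvPolynomial.pderiv i Q + P * polyLaplacian Q := by
  simp only [polyLaplacian, Finset.sum_mul, Finset.mul_sum, ← Finset.sum_add_distrib]
  refine Finset.sum_congr rfl fun i _ => ?_
  simp only [Derivation.leibniz, map_add, smul_eq_mul]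
  ring

theorem pderiv_linForm {N : ℕ} (y : EuclideanSpace ℝ (Fin (N + 1))) (i : Fin (N + 1)) :
    MvPolynomial.pderiv i (linForm y) = MvPolynomial.C (y i) := by
  simp only [linForm, map_sum]
  rw [Finset.sum_eq_single i]
  · simp
  · intro j _ hj
    simp [MvPolynomial.pderiv_X_of_ne hj]
  · simp

theorem pderiv_normSqPoly (N : ℕ) (i : Fin (N + 1)) :
    MvPolynomial.pderiv i (normSqPoly N) = 2 * MvPolynomial.X i := by
  simp only [normSqPoly, map_sum]
  rw [Finset.sum_eq_single i]
  · simp [Derivation.leibniz_pow]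
  · intro j _ hj
    simp [Derivation.leibniz_pow, MvPolynomial.pderiv_X_of_ne hj]
  · simp

theorem polyLaplacian_linForm_mul {N : ℕ} (y : EuclideanSpace ℝ (Fin (N + 1)))
    (P : MvPolynomial (Fin (N + 1)) ℝ) :
    polyLaplacian (linForm y * P) = 2 * dirDeriv y P + linForm y * polyLaplacian P := by
  rw [polyLaplacian_mul, dirDeriv_eq_sum]
  simp [polyLaplacian, pderiv_linForm]

theorem polyLaplacian_normSqPoly_mul {N k : ℕ} {P : MvPolynomial (Fin (N + 1)) ℝ}
    (hP : P.IsHomogeneous k) :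
    polyLaplacian (normSqPoly N * P) =
      (2 * (N + 1) + 4 * k) * P + normSqPoly N * polyLaplacian P := by
  rw [polyLaplacian_mul]
  have h1 : polyLaplacian (normSqPoly N) = 2 * (N + 1) := by
    have : ∀ i, MvPolynomial.pderiv i (2 * MvPolynomial.X i : MvPolynomial (Fin (N + 1)) ℝ) =
        2 := by
      intro i
      have h2 : MvPolynomial.pderiv i (2 : MvPolynomial (Fin (N + 1)) ℝ) = 0 :=
        Derivation.map_natCast _ 2
      simp [Derivation.leibniz, h2]
    simp only [polyLaplacian, pderiv_normSqPoly, this]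
    simp
    ring
  have h2 : ∑ i, MvPolynomial.pderiv i (normSqPoly N) * MvPolynomial.pderiv i P = 2 * (k * P) := by
    have := hP.sum_X_mul_pderiv
    rw [nsmul_eq_mul] at this
    rw [← this, Finset.mul_sum]
    exact Finset.sum_congr rfl fun i _ => by rw [pderiv_normSqPoly]; ring
  rw [h1, h2]
  ring

theorem polyLaplacian_C_mul {N : ℕ} (c : ℝ) (P : MvPolynomial (Fin (N + 1)) ℝ) :
    polyLaplacian (MvPolynomial.C c * P) = MvPolynomial.C c * polyLaplacian P := by
  rw [polyLaplacian_mul]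
  simp [polyLaplacian]

theorem polyLaplacian_zonalPoly {N : ℕ} {l : ℝ} (hl : 2 * l + 1 = N)
    {y : EuclideanSpace ℝ (Fin (N + 1))} (hy : ‖y‖ = 1) (k : ℕ) :
    polyLaplacian (zonalPoly l y k) = 0 := by
  have hl' : 2 * MvPolynomial.C l + 1 = (N : MvPolynomial (Fin (N + 1)) ℝ) := by
    rw [← map_natCast (MvPolynomial.C (σ := Fin (N + 1)) (R := ℝ)), ← hl]
    rw [map_add, map_mul, map_ofNat, map_one]
  induction k using Nat.twoStepInduction with
  | zero => simp [zonalPoly, polyLaplacian]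
  | one =>
    rw [zonalPoly, polyLaplacian_C_mul]
    simp [polyLaplacian, pderiv_linForm]
  | more k h0 h1 =>
    have hne : ((k : MvPolynomial (Fin (N + 1)) ℝ) + 2) ≠ 0 := by
      exact_mod_cast (by omega : k + 2 ≠ 0)
    have hsub : ∀ P Q : MvPolynomial (Fin (N + 1)) ℝ,
        polyLaplacian (P - Q) = polyLaplacian P - polyLaplacian Q := fun P Q => by
      simp [polyLaplacian]
    have hC : ∀ a : ℝ, ∀ P, ∀ A : MvPolynomial (Fin (N + 1)) ℝ, A = MvPolynomial.C a →
      polyLaplacian (A * P) = A * polyLaplacian P := fun a P A hA => by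
        rw [hA, polyLaplacian_C_mul]
    have := congrArg polyLaplacian (zonalPoly_recurrence l y k)
    rw [hsub, hC (k + 2) _ _ (by simp only [map_add, map_natCast, map_ofNat]),
      hC (2 * (k + 1 + l)) (linForm y * zonalPoly l y (k + 1)) _
        (by simp only [map_add, map_mul, map_natCast, map_one, map_ofNat]),
      hC (k + 2 * l) (normSqPoly N * zonalPoly l y k) _
        (by simp only [map_add, map_mul, map_natCast, map_ofNat]), polyLaplacian_linForm_mul,
      polyLaplacian_normSqPoly_mul (isHomogeneous_zonalPoly l y k), h0, h1,
      dirDeriv_zonalPoly l hy] at this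
    apply mul_left_cancel₀ hne
    rw [this]
    linear_combination 2 * ((k : MvPolynomial (Fin (N + 1)) ℝ) + 2 * MvPolynomial.C l) *
      zonalPoly l y k * hl'

theorem polyLaplacian_dirDeriv {N : ℕ} (v : EuclideanSpace ℝ (Fin (N + 1)))
    (P : MvPolynomial (Fin (N + 1)) ℝ) :
    polyLaplacian (dirDeriv v P) = dirDeriv v (polyLaplacian P) := by
  have h : ∀ i : Fin (N + 1), ⁅MvPolynomial.pderiv (R := ℝ) i, dirDeriv v⁆ = 0 := by
    intro i
    refine MvPolynomial.derivation_ext fun j => ?_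
    rw [Derivation.commutator_apply, dirDeriv, MvPolynomial.mkDerivation_X]
    by_cases hij : j = i
    · subst hij
      simp
    · simp [MvPolynomial.pderiv_X_of_ne hij]
  have h' : ∀ i Q, MvPolynomial.pderiv i (dirDeriv v Q) = dirDeriv v (MvPolynomial.pderiv i Q) := by
    intro i Q
    have := congrArg (fun D => D Q) (h i)
    simpa [Derivation.commutator_apply, sub_eq_zero] using this
  simp only [polyLaplacian, map_sum, h']

/-- The integral of a polynomial over the sphere. -/
def sphInt {N : ℕ} (P : MvPolynomial (Fin (N + 1)) ℝ) : ℝ :=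
  ∫ x : Sph N, polyEval P x ∂(sphMeasure N)

theorem sphInt_add {N : ℕ} (P Q : MvPolynomial (Fin (N + 1)) ℝ) :
    sphInt (P + Q) = sphInt P + sphInt Q := by
  unfold sphInt
  rw [← integral_add (integrable_polyEval P) (integrable_polyEval Q)]
  simp [polyEval]

theorem sphInt_C_mul {N : ℕ} (c : ℝ) (P : MvPolynomial (Fin (N + 1)) ℝ) :
    sphInt (MvPolynomial.C c * P) = c * sphInt P := by
  unfold sphInt
  rw [← integral_const_mul]
  simp [polyEval]

theorem sphInt_natCast_mul {N : ℕ} (c : ℕ) (P : MvPolynomial (Fin (N + 1)) ℝ) :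
    sphInt ((c : MvPolynomial (Fin (N + 1)) ℝ) * P) = c * sphInt P := by
  rw [← sphInt_C_mul, map_natCast]

theorem sphInt_sum {N : ℕ} {ι : Type*} (s : Finset ι) (P : ι → MvPolynomial (Fin (N + 1)) ℝ) :
    sphInt (∑ i ∈ s, P i) = ∑ i ∈ s, sphInt (P i) := by
  unfold sphInt
  rw [← integral_finsetSum _ fun i _ => integrable_polyEval (P i)]
  simp [polyEval]

theorem sphInt_normSqPoly_mul {N : ℕ} (P : MvPolynomial (Fin (N + 1)) ℝ) :
    sphInt (normSqPoly N * P) = sphInt P := by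
  unfold sphInt
  refine integral_congr_ae (.of_forall fun x => ?_)
  have : ‖(x : EuclideanSpace ℝ (Fin (N + 1)))‖ = 1 := by simp
  simp only [polyEval_mul, polyEval_normSqPoly, this]
  ring

theorem sphInt_linForm_mul {N d : ℕ} (v : EuclideanSpace ℝ (Fin (N + 1)))
    {P : MvPolynomial (Fin (N + 1)) ℝ} (hP : P.IsHomogeneous d) :
    ((N : ℝ) + d) * sphInt (linForm v * P) = sphInt (dirDeriv v P) :=
  integral_sphere_linForm_mul v hP

theorem sphInt_harmonic {N k : ℕ} (hN : 0 < N) {h : MvPolynomial (Fin (N + 1)) ℝ}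
    (hh : h.IsHomogeneous (k + 1))
    (hl : polyLaplacian h = 0) : sphInt h = 0 := by
  have e := hh.sum_X_mul_pderiv
  have hlin : ∀ i : Fin (N + 1), linForm (EuclideanSpace.single i (1 : ℝ)) = MvPolynomial.X i := by
    intro i
    rw [linForm, Finset.sum_eq_single i]
    · simp
    · intro j _ hj
      simp [hj]
    · simp
  have hdir : ∀ (i : Fin (N + 1)) Q,
      dirDeriv (EuclideanSpace.single i (1 : ℝ)) Q = MvPolynomial.pderiv i Q := by
    intro i Q
    rw [dirDeriv_eq_sum, Finset.sum_eq_single i]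
    · simp
    · intro j _ hj
      simp [hj]
    · simp
  have key : ∀ i, ((N : ℝ) + k) * sphInt (MvPolynomial.X i * MvPolynomial.pderiv i h) =
      sphInt (MvPolynomial.pderiv i (MvPolynomial.pderiv i h)) := by
    intro i
    have := sphInt_linForm_mul (EuclideanSpace.single i (1 : ℝ)) (hh.pderiv (i := i))
    rwa [hlin, hdir] at this
  have hs : ((N : ℝ) + k) * sphInt (∑ i, MvPolynomial.X i * MvPolynomial.pderiv i h) =
      sphInt (polyLaplacian h) := by
    rw [sphInt_sum, Finset.mul_sum, polyLaplacian, sphInt_sum]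
    exact Finset.sum_congr rfl fun i _ => key i
  rw [e, hl, nsmul_eq_mul, sphInt_natCast_mul] at hs
  have h0 : sphInt (0 : MvPolynomial (Fin (N + 1)) ℝ) = 0 := by simp [sphInt, polyEval]
  rw [h0] at hs
  have h1 : ((N : ℝ) + k) ≠ 0 := by positivity
  have h2 : (((k + 1 : ℕ) : ℝ)) ≠ 0 := by positivity
  exact ((mul_eq_zero.1 ((mul_eq_zero.1 hs).resolve_left h1))).resolve_left h2

theorem sphInt_linForm_pow_succ_mul {N j k : ℕ} {y : EuclideanSpace ℝ (Fin (N + 1))}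
    (hy : ‖y‖ = 1) {h : MvPolynomial (Fin (N + 1)) ℝ} (hh : h.IsHomogeneous k) :
    ((N : ℝ) + (j + k)) * sphInt (linForm y ^ (j + 1) * h) =
      j * sphInt (linForm y ^ (j - 1) * h) + sphInt (linForm y ^ j * dirDeriv y h) := by
  have h1 := ((isHomogeneous_linForm y).pow j).mul hh
  have h2 := sphInt_linForm_mul y h1
  rw [Derivation.leibniz, Derivation.leibniz_pow, dirDeriv_linForm_self hy] at h2
  rw [one_mul, ← mul_assoc, ← pow_succ'] at h2
  push_cast at h2
  rw [h2, add_comm, sphInt_add]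
  congr 1
  rw [← sphInt_natCast_mul]
  congr 1
  simp only [smul_eq_mul, nsmul_eq_mul]
  ring

theorem sphInt_linForm_pow_mul_eq_zero {N : ℕ} (hN : 0 < N) {y : EuclideanSpace ℝ (Fin (N + 1))}
    (hy : ‖y‖ = 1) (j : ℕ) : ∀ {k : ℕ} {h : MvPolynomial (Fin (N + 1)) ℝ}, h.IsHomogeneous k →
      polyLaplacian h = 0 → j < k → sphInt (linForm y ^ j * h) = 0 := by
  induction j using Nat.strong_induction_on with
  | _ j ih =>
    intro k h hh hl hjk
    obtain ⟨m, rfl⟩ : ∃ m, k = m + 1 := ⟨k - 1, by omega⟩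
    rcases j with _ | j
    · rw [pow_zero, one_mul]
      exact sphInt_harmonic hN hh hl
    · have key := sphInt_linForm_pow_succ_mul hy (j := j) hh
      have hd : polyLaplacian (dirDeriv y h) = 0 := by
        rw [polyLaplacian_dirDeriv, hl, map_zero]
      rw [ih (j - 1) (by omega) hh hl (by omega),
        ih j (by omega) (isHomogeneous_dirDeriv y hh) hd (by omega), mul_zero, add_zero] at key
      have : (N : ℝ) + (j + (m + 1 : ℕ)) ≠ 0 := by positivity
      exact (mul_eq_zero.1 key).resolve_left this

theorem polyEval_dirDeriv_self {N k : ℕ} (y : EuclideanSpace ℝ (Fin (N + 1)))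
    {h : MvPolynomial (Fin (N + 1)) ℝ} (hh : h.IsHomogeneous k) :
    polyEval (dirDeriv y h) y = k * polyEval h y := by
  have := congrArg (fun P => polyEval P y) hh.sum_X_mul_pderiv
  simp only [polyEval, nsmul_eq_mul, map_sum, map_mul, map_natCast, MvPolynomial.eval_X] at this
  rw [polyEval, polyEval, ← this, dirDeriv_eq_sum]
  simp

/-- The constants `κ_k` in `∫ ⟪x, y⟫ ^ k h(x) dσ(x) = κ_k h(y)` for `h` harmonic of degree `k`. -/
def momentConst (N : ℕ) : ℕ → ℝ
  | 0 => (sphMeasure N).real Set.univ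
  | k + 1 => (k + 1) / (N + (k + (k + 1))) * momentConst N k

theorem sphInt_linForm_pow_mul_harmonic {N : ℕ} (hN : 0 < N) {y : EuclideanSpace ℝ (Fin (N + 1))}
    (hy : ‖y‖ = 1) (k : ℕ) : ∀ {h : MvPolynomial (Fin (N + 1)) ℝ}, h.IsHomogeneous k →
      polyLaplacian h = 0 → sphInt (linForm y ^ k * h) = momentConst N k * polyEval h y := by
  induction k with
  | zero =>
    intro h hh _
    have h0 : h = MvPolynomial.C (MvPolynomial.coeff 0 h) :=
      MvPolynomial.totalDegree_eq_zero_iff_eq_C.1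
        ((MvPolynomial.totalDegree_zero_iff_isHomogeneous _).2 hh)
    rw [pow_zero, one_mul, h0]
    simp [sphInt, polyEval, momentConst]
  | succ k ih =>
    intro h hh hl
    have key := sphInt_linForm_pow_succ_mul hy (j := k) hh
    have hd : polyLaplacian (dirDeriv y h) = 0 := by
      rw [polyLaplacian_dirDeriv, hl, map_zero]
    rw [sphInt_linForm_pow_mul_eq_zero hN hy (k - 1) hh hl (by omega),
      ih (isHomogeneous_dirDeriv y hh) hd, polyEval_dirDeriv_self y hh] at key
    have : (N : ℝ) + (k + (k + 1)) ≠ 0 := by positivity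
    rw [momentConst]
    push_cast at key
    field_simp
    linear_combination key

/-- The leading coefficients of the Gegenbauer polynomials. -/
def gegenbauerLead (l : ℝ) : ℕ → ℝ
  | 0 => 1
  | k + 1 => 2 * (k + l) / (k + 1) * gegenbauerLead l k

theorem sphInt_zonalPoly_mul {N k : ℕ} (hN : 0 < N) (l : ℝ) {y : EuclideanSpace ℝ (Fin (N + 1))}
    (hy : ‖y‖ = 1) {h : MvPolynomial (Fin (N + 1)) ℝ} (hh : h.IsHomogeneous k)
    (hl : polyLaplacian h = 0) (m : ℕ) : ∀ j, j + m ≤ k →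
      sphInt (linForm y ^ j * (zonalPoly l y m * h)) =
        gegenbauerLead l m * sphInt (linForm y ^ (j + m) * h) := by
  induction m using Nat.twoStepInduction with
  | zero => intro j _; simp [zonalPoly, gegenbauerLead]
  | one =>
    intro j _
    rw [zonalPoly, ← sphInt_C_mul, gegenbauerLead, gegenbauerLead]
    congr 1
    simp only [Nat.cast_zero, zero_add, div_one, mul_one]
    ring
  | more m h0 h1 =>
    intro j hj
    have e1 : linForm y ^ j * (zonalPoly l y (m + 2) * h) =
        MvPolynomial.C (2 * (m + 1 + l) / (m + 2)) *
          (linForm y ^ (j + 1) * (zonalPoly l y (m + 1) * h)) +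
        MvPolynomial.C (-((m + 2 * l) / (m + 2))) *
          (normSqPoly N * (linForm y ^ j * (zonalPoly l y m * h))) := by
      rw [zonalPoly, map_neg]
      ring
    rw [e1, sphInt_add, sphInt_C_mul, sphInt_C_mul, sphInt_normSqPoly_mul, h0 j (by omega),
      h1 (j + 1) (by omega), sphInt_linForm_pow_mul_eq_zero hN hy (j + m) hh hl (by omega),
      show j + (m + 2) = j + 1 + (m + 1) by ring, gegenbauerLead.eq_2 l (m + 1)]
    push_cast
    rw [show (m : ℝ) + 1 + 1 = m + 2 by ring]
    ring

theorem gegenbauerLead_mul_momentConst {N : ℕ} {l : ℝ} (hl : 2 * l + 1 = N) (hl0 : 0 < l) (k : ℕ) :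
    (k + l) * (gegenbauerLead l k * momentConst N k) = l * (sphMeasure N).real Set.univ := by
  induction k with
  | zero => simp [gegenbauerLead, momentConst]
  | succ k ih =>
    rw [← ih, gegenbauerLead, momentConst, ← hl]
    have : (2 * l + 1 + (k + (k + 1)) : ℝ) ≠ 0 := by positivity
    push_cast
    field_simp
    ring

/-- The zonal reproducing formula for spherical harmonics. -/
theorem integral_gegenbauer_mul {N k : ℕ} {l : ℝ} (hl : 2 * l + 1 = N) (hl0 : 0 < l) (y : Sph N)
    {g : Sph N → ℝ} (hg : IsSphericalHarmonic N k g) :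
    (k + l) * ∫ x : Sph N, gegenbauer l ⟪(x : EuclideanSpace ℝ (Fin (N + 1))), y⟫ k * g x
      ∂(sphMeasure N) = l * (sphMeasure N).real Set.univ * g y := by
  obtain ⟨P, hP, hlap, hgP⟩ := hg
  have hN : 0 < N := by
    have : (0 : ℝ) < N := by rw [← hl]; positivity
    exact_mod_cast this
  have hn : ∀ x : Sph N, ‖(x : EuclideanSpace ℝ (Fin (N + 1)))‖ = 1 := fun x => by simp
  have e := sphInt_zonalPoly_mul hN l (hn y) hP hlap k 0 (by omega)
  rw [pow_zero, one_mul, zero_add, sphInt_linForm_pow_mul_harmonic hN (hn y) k hP hlap] at e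
  have e2 : ∫ x : Sph N, gegenbauer l ⟪(x : EuclideanSpace ℝ (Fin (N + 1))), y⟫ k * g x
      ∂(sphMeasure N) = sphInt (zonalPoly l y k * P) := by
    refine integral_congr_ae (.of_forall fun x => ?_)
    simp only
    rw [polyEval_mul, polyEval_zonalPoly l _ _ (hn x), hgP x, polyEval]
  rw [e2, e, hgP y, ← gegenbauerLead_mul_momentConst hl hl0 k, polyEval]
  ring

theorem isSphericalHarmonic_gegenbauer {N : ℕ} {l : ℝ} (hl : 2 * l + 1 = N) (y : Sph N) (k : ℕ) :
    IsSphericalHarmonic N k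
      (fun x : Sph N => gegenbauer l ⟪(x : EuclideanSpace ℝ (Fin (N + 1))), y⟫ k) := by
  have h2 := polyLaplacian_zonalPoly hl (norm_eq_of_mem_sphere y) k
  refine ⟨zonalPoly l (y : EuclideanSpace ℝ (Fin (N + 1))) k,
    isHomogeneous_zonalPoly l (y : EuclideanSpace ℝ (Fin (N + 1))) k, h2, fun x => ?_⟩
  have h3 := polyEval_zonalPoly l (y : EuclideanSpace ℝ (Fin (N + 1))) x (norm_eq_of_mem_sphere x) k
  simp only
  rw [← h3, polyEval]

theorem IsSphericalHarmonic.continuous {N k : ℕ} {g : Sph N → ℝ} (hg : IsSphericalHarmonic N k g) :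
    Continuous g := by
  obtain ⟨P, _, _, h⟩ := hg
  exact ((continuous_polyEval P).comp continuous_subtype_val).congr fun x => (h x).symm

theorem Continuous.integrable_sphMeasure {N : ℕ} {g : Sph N → ℝ} (hg : Continuous g) :
    Integrable g (sphMeasure N) :=
  hg.integrable_of_hasCompactSupport (HasCompactSupport.of_compactSpace _)

/-- The addition theorem for spherical harmonics. -/
theorem IsFourierLaplaceBasis.sum_mul_eq {N : ℕ} {a : ℕ → ℕ} {Y : (k : ℕ) → Fin (a k) → Sph N → ℝ}
    (hY : IsFourierLaplaceBasis N a Y) {l : ℝ} (hl : 2 * l + 1 = N) (hl0 : 0 < l) (k : ℕ)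
    (x y : Sph N) :
    l * (sphMeasure N).real Set.univ * ∑ j, Y k j x * Y k j y =
      (k + l) * gegenbauer l ⟪(x : EuclideanSpace ℝ (Fin (N + 1))), y⟫ k := by
  obtain ⟨c, hc⟩ := (Submodule.mem_span_range_iff_exists_fun ℝ).1
    (hY.spanning k _ (isSphericalHarmonic_gegenbauer hl y k))
  have hc' : ∀ x : Sph N, gegenbauer l ⟪(x : EuclideanSpace ℝ (Fin (N + 1))), y⟫ k =
      ∑ j, c j * Y k j x := by
    intro x
    have := congrFun hc x
    simpa using this.symm
  have hcoef : ∀ j, ∫ x : Sph N, gegenbauer l ⟪(x : EuclideanSpace ℝ (Fin (N + 1))), y⟫ k * Y k j x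
      ∂(sphMeasure N) = c j := by
    intro j
    have : ∀ x : Sph N, gegenbauer l ⟪(x : EuclideanSpace ℝ (Fin (N + 1))), y⟫ k * Y k j x =
        ∑ i, c i * (Y k i x * Y k j x) := by
      intro x
      rw [hc', Finset.sum_mul]
      exact Finset.sum_congr rfl fun i _ => by ring
    simp only [this]
    rw [integral_finsetSum]
    · simp [integral_const_mul, hY.orthonormal]
    · intro i _
      exact (((hY.harmonic k i).continuous.mul
        (hY.harmonic k j).continuous).integrable_sphMeasure).const_mul _
  rw [hc', Finset.mul_sum, Finset.mul_sum]
  refine Finset.sum_congr rfl fun j _ => ?_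
  have := integral_gegenbauer_mul hl hl0 y (hY.harmonic k j)
  rw [hcoef] at this
  linear_combination (-Y k j x) * this

theorem integral_gegenbauer_eq_zero {N k : ℕ} {l : ℝ} (hl : 2 * l + 1 = N) (hl0 : 0 < l)
    (y : Sph N) : ∫ x : Sph N, gegenbauer l ⟪(x : EuclideanSpace ℝ (Fin (N + 1))), y⟫ (k + 1)
      ∂(sphMeasure N) = 0 := by
  have hN : 0 < N := by
    have : (0 : ℝ) < N := by rw [← hl]; positivity
    exact_mod_cast this
  have h2 := polyLaplacian_zonalPoly hl (norm_eq_of_mem_sphere y) (k + 1)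
  have h3 := sphInt_harmonic hN (isHomogeneous_zonalPoly l _ (k + 1)) h2
  rw [← h3, sphInt]
  refine integral_congr_ae (.of_forall fun x => ?_)
  exact (polyEval_zonalPoly l _ _ (norm_eq_of_mem_sphere x) (k + 1)).symm

/-! ### Generating functions -/

theorem cesaroA_zero {β : ℝ} (hβ : -1 < β) : cesaroA β 0 = 1 := by
  have : Real.Gamma (β + 1) ≠ 0 := (Real.Gamma_pos_of_pos (by linarith)).ne'
  simp [cesaroA, this]

theorem cesaroA_pos {β : ℝ} (hβ : -1 < β) (n : ℕ) : 0 < cesaroA β n := by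
  have h1 : 0 < Real.Gamma (β + 1) := Real.Gamma_pos_of_pos (by linarith)
  have h2 : 0 < Real.Gamma (β + n + 1) := Real.Gamma_pos_of_pos (by
    have : (0 : ℝ) ≤ n := n.cast_nonneg
    linarith)
  unfold cesaroA
  positivity

theorem cesaroA_succ {β : ℝ} (hβ : -1 < β) (n : ℕ) :
    (n + 1) * cesaroA β (n + 1) = (n + 1 + β) * cesaroA β n := by
  have h1 : Real.Gamma (β + 1) ≠ 0 := (Real.Gamma_pos_of_pos (by linarith)).ne'
  have h2 : β + n + 1 ≠ 0 := by
    have : (0 : ℝ) ≤ n := n.cast_nonneg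
    linarith
  have h3 := Real.Gamma_add_one h2
  have h4 : ((Nat.factorial n : ℕ) : ℝ) ≠ 0 := by positivity
  unfold cesaroA
  push_cast [Nat.factorial_succ]
  rw [show β + ((n : ℝ) + 1) + 1 = β + n + 1 + 1 by ring, h3]
  field_simp
  ring

theorem cesaroA_sub_one {α : ℝ} (hα : 0 < α) (n : ℕ) :
    cesaroA α (n + 1) - cesaroA α n = cesaroA (α - 1) (n + 1) := by
  have h1 : Real.Gamma α ≠ 0 := (Real.Gamma_pos_of_pos hα).ne'
  have h2 : α + n + 1 ≠ 0 := by positivity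
  have h3 := Real.Gamma_add_one h2
  have h5 := Real.Gamma_add_one hα.ne'
  have h4 : ((Nat.factorial n : ℕ) : ℝ) ≠ 0 := by positivity
  unfold cesaroA
  push_cast [Nat.factorial_succ]
  rw [show α + ((n : ℝ) + 1) + 1 = α + n + 1 + 1 by ring, h3, h5,
    show α - 1 + ((n : ℝ) + 1) + 1 = α + n + 1 by ring, show α - 1 + 1 = α by ring]
  field_simp
  ring

/-- The power series `∑ A_n^β u^n z^n = (1 - u z) ^ (-β - 1)`. -/
def cesaroSeries (β : ℝ) (u : ℂ) : PowerSeries ℂ :=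
  PowerSeries.mk fun n => (cesaroA β n : ℂ) * u ^ n

theorem coeff_derivative_cesaroSeries {β : ℝ} (hβ : -1 < β) (u : ℂ) :
    (1 - PowerSeries.C u * PowerSeries.X) * PowerSeries.derivative ℂ (cesaroSeries β u) =
      PowerSeries.C ((β + 1) * u) * cesaroSeries β u := by
  have key : ∀ n : ℕ, ((n : ℂ) + 1) * cesaroA β (n + 1) = (n + 1 + β) * cesaroA β n := fun n => by
    exact_mod_cast congrArg (fun x : ℝ => (x : ℂ)) (cesaroA_succ hβ n)
  ext n
  rw [sub_mul, one_mul, mul_assoc, map_sub, PowerSeries.coeff_C_mul, PowerSeries.coeff_C_mul,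
    PowerSeries.coeff_derivative]
  rcases n with _ | n
  · have := key 0
    simp only [cesaroSeries, PowerSeries.coeff_mk, PowerSeries.coeff_zero_X_mul]
    push_cast at this ⊢
    linear_combination u * this
  · have := key (n + 1)
    rw [PowerSeries.coeff_succ_X_mul, PowerSeries.coeff_derivative]
    simp only [cesaroSeries, PowerSeries.coeff_mk]
    push_cast at this ⊢
    linear_combination u ^ (n + 2) * this

theorem cesaroSeries_mul_one_sub_X {α : ℝ} (hα : 0 < α) :
    cesaroSeries α 1 * (1 - PowerSeries.X) = cesaroSeries (α - 1) 1 := by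
  ext n
  rw [mul_sub, mul_one, map_sub]
  rcases n with _ | n
  · simp [cesaroSeries, cesaroA_zero (show -1 < α by linarith),
      cesaroA_zero (show -1 < α - 1 by linarith)]
  · rw [PowerSeries.coeff_succ_mul_X]
    simp only [cesaroSeries, PowerSeries.coeff_mk, one_pow, mul_one]
    exact_mod_cast cesaroA_sub_one hα n

theorem coeff_eq_gegenbauer {l t : ℝ} {F : PowerSeries ℂ} (h0 : PowerSeries.coeff 0 F = 1)
    (hF : (1 - PowerSeries.C (2 * t : ℂ) * PowerSeries.X + PowerSeries.X ^ 2) *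
      PowerSeries.derivative ℂ F =
      PowerSeries.C (2 * l : ℂ) * (PowerSeries.C (t : ℂ) - PowerSeries.X) * F) (n : ℕ) :
    PowerSeries.coeff n F = gegenbauer l t n := by
  have hcoef : ∀ n, PowerSeries.coeff n
      ((1 - PowerSeries.C (2 * t : ℂ) * PowerSeries.X + PowerSeries.X ^ 2) *
        PowerSeries.derivative ℂ F) = PowerSeries.coeff n
      (PowerSeries.C (2 * l : ℂ) * (PowerSeries.C (t : ℂ) - PowerSeries.X) * F) := fun n => by
    rw [hF]
  have e1 : (1 - PowerSeries.C (2 * t : ℂ) * PowerSeries.X + PowerSeries.X ^ 2) *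
      PowerSeries.derivative ℂ F = PowerSeries.derivative ℂ F -
        PowerSeries.C (2 * t : ℂ) * (PowerSeries.X * PowerSeries.derivative ℂ F) +
        PowerSeries.X * (PowerSeries.X * PowerSeries.derivative ℂ F) := by ring
  have e2 : PowerSeries.C (2 * l : ℂ) * (PowerSeries.C (t : ℂ) - PowerSeries.X) * F =
      PowerSeries.C (2 * l : ℂ) * (PowerSeries.C (t : ℂ) * F) -
        PowerSeries.C (2 * l : ℂ) * (PowerSeries.X * F) := by ring
  rw [e1, e2] at hcoef
  simp only [map_sub, map_add, PowerSeries.coeff_C_mul] at hcoef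
  have hX : ∀ (n : ℕ) (G : PowerSeries ℂ), PowerSeries.coeff (n + 1) (PowerSeries.X * G) =
      PowerSeries.coeff n G := fun n G => PowerSeries.coeff_succ_X_mul n G
  have hX0 : ∀ (G : PowerSeries ℂ), PowerSeries.coeff 0 (PowerSeries.X * G) = 0 := fun G =>
    PowerSeries.coeff_zero_X_mul G
  induction n using Nat.twoStepInduction with
  | zero => simpa [gegenbauer] using h0
  | one =>
    have := hcoef 0
    rw [hX0, hX0, hX0, PowerSeries.coeff_derivative, h0] at this
    rw [gegenbauer]
    push_cast at this ⊢
    simp only [zero_add] at this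
    linear_combination this
  | more n ih0 ih1 =>
    have hn : ((n : ℂ) + 2) ≠ 0 := by exact_mod_cast (by omega : n + 2 ≠ 0)
    have := hcoef (n + 1)
    rw [hX, hX, hX, PowerSeries.coeff_derivative, PowerSeries.coeff_derivative, ih0, ih1] at this
    have hX2 : PowerSeries.coeff n (PowerSeries.X * PowerSeries.derivative ℂ F) =
        (n : ℂ) * (gegenbauer l t n : ℂ) := by
      rcases n with _ | n
      · rw [hX0]; simp
      · rw [hX, PowerSeries.coeff_derivative, ih0]
        push_cast
        ring
    rw [hX2] at this
    rw [gegenbauer]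
    push_cast at this ⊢
    apply mul_left_cancel₀ hn
    field_simp
    linear_combination this

theorem sum_cesaroA_mul_gegenbauer {l α : ℝ} (hl : 0 < l) (hα : 0 < α) {u : ℂ} (hu : ‖u‖ = 1)
    (n : ℕ) :
    ((∑ k ∈ Finset.range (n + 1), cesaroA α (n - k) * ((k + l) * gegenbauer l u.re k) : ℝ) : ℂ) =
      l * PowerSeries.coeff n ((1 + PowerSeries.X) * (cesaroSeries (α - 1) 1 *
        (cesaroSeries l u * cesaroSeries l (starRingEnd ℂ u)))) := by
  set v := starRingEnd ℂ u with hv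
  set P := cesaroSeries l u with hP
  set Q := cesaroSeries l v with hQ
  have dP := coeff_derivative_cesaroSeries (show -1 < l by linarith) u
  have dQ := coeff_derivative_cesaroSeries (show -1 < l by linarith) v
  have huv : PowerSeries.C u * PowerSeries.C v = 1 := by
    rw [← map_mul, hv, Complex.mul_conj, Complex.normSq_eq_norm_sq, hu]
    simp
  have huv' : PowerSeries.C u + PowerSeries.C v = 2 * PowerSeries.C (u.re : ℂ) := by
    rw [← map_add, hv, Complex.add_conj, Complex.ofReal_mul, map_mul, Complex.ofReal_ofNat,
      map_ofNat]
  set t := u.re with ht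
  set W : PowerSeries ℂ := 1 - 2 * PowerSeries.C (t : ℂ) * PowerSeries.X + PowerSeries.X ^ 2 with hW
  have hWf : W = (1 - PowerSeries.C u * PowerSeries.X) * (1 - PowerSeries.C v * PowerSeries.X) := by
    rw [hW]
    linear_combination PowerSeries.X * huv' - PowerSeries.X ^ 2 * huv
  have hd2 : PowerSeries.derivative ℂ (2 : PowerSeries ℂ) = 0 := Derivation.map_natCast _ 2
  have dW : PowerSeries.derivative ℂ W =
      2 * PowerSeries.X - 2 * PowerSeries.C (t : ℂ) := by
    rw [hW]
    simp only [map_add, map_sub, Derivation.leibniz, PowerSeries.derivative_X,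
      PowerSeries.derivative_C, PowerSeries.derivative_one, pow_two, smul_eq_mul, hd2]
    ring
  have hC : ∀ w : ℂ, PowerSeries.C ((l + 1) * w) =
      (PowerSeries.C (l : ℂ) + 1) * PowerSeries.C w := fun w => by
    rw [map_mul, map_add, map_one]
  rw [hC] at dP dQ
  have dF : PowerSeries.derivative ℂ (W * (P * Q)) =
      2 * PowerSeries.C (l : ℂ) * (PowerSeries.C (t : ℂ) - PowerSeries.X) * (P * Q) := by
    rw [Derivation.leibniz, Derivation.leibniz, dW, smul_eq_mul, smul_eq_mul, smul_eq_mul,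
      smul_eq_mul, hWf]
    linear_combination (1 - PowerSeries.C v * PowerSeries.X) * Q * dP +
      (1 - PowerSeries.C u * PowerSeries.X) * P * dQ +
      (PowerSeries.C (l : ℂ) + 1) * P * Q * (huv' - 2 * PowerSeries.X * huv)
  have hcoef : ∀ k, PowerSeries.coeff k (W * (P * Q)) = gegenbauer l t k := by
    refine coeff_eq_gegenbauer ?_ ?_
    · have h1 : ∀ w, PowerSeries.constantCoeff (cesaroSeries l w) = 1 := fun w => by
        rw [← PowerSeries.coeff_zero_eq_constantCoeff_apply]
        simp [cesaroSeries, cesaroA_zero (show -1 < l by linarith)]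
      rw [PowerSeries.coeff_zero_eq_constantCoeff_apply, map_mul, map_mul, hP, hQ, h1, h1, hW]
      simp
    · rw [dF]
      simp only [map_mul, map_ofNat]
      rw [hW]
      ring
  have hcoef' : ∀ k : ℕ, PowerSeries.coeff k (PowerSeries.X * PowerSeries.derivative ℂ
      (W * (P * Q)) +
      PowerSeries.C (l : ℂ) * (W * (P * Q))) = ((k : ℂ) + l) * gegenbauer l t k := by
    intro k
    rw [map_add, PowerSeries.coeff_C_mul, hcoef]
    rcases k with _ | k
    · rw [PowerSeries.coeff_zero_X_mul]; simp
    · rw [PowerSeries.coeff_succ_X_mul, PowerSeries.coeff_derivative, hcoef]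
      push_cast
      ring
  have hid : cesaroSeries α 1 * (PowerSeries.X * PowerSeries.derivative ℂ (W * (P * Q)) +
      PowerSeries.C (l : ℂ) * (W * (P * Q))) = PowerSeries.C (l : ℂ) *
        ((1 + PowerSeries.X) * (cesaroSeries (α - 1) 1 * (P * Q))) := by
    rw [dF, ← cesaroSeries_mul_one_sub_X hα, hW]
    ring
  rw [← PowerSeries.coeff_C_mul, ← hid, mul_comm, PowerSeries.coeff_mul,
    Finset.Nat.sum_antidiagonal_eq_sum_range_succ_mk]
  push_cast
  refine Finset.sum_congr rfl fun k _ => ?_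
  rw [hcoef']
  simp only [cesaroSeries, PowerSeries.coeff_mk]
  ring

theorem multichoose_eq_cesaroA {β : ℝ} (hβ : -1 < β) (n : ℕ) :
    Ring.multichoose ((β : ℂ) + 1) n = cesaroA β n := by
  have h : ∀ n, (n.factorial : ℂ) * Ring.multichoose ((β : ℂ) + 1) n =
      (ascPochhammer ℂ n).eval ((β : ℂ) + 1) := by
    intro n
    rw [← Polynomial.ascPochhammer_smeval_eq_eval,
      ← Ring.factorial_nsmul_multichoose_eq_ascPochhammer,
      nsmul_eq_mul]
  induction n with
  | zero => simp [cesaroA_zero hβ]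
  | succ n ih =>
    have h1 := h (n + 1)
    rw [ascPochhammer_succ_eval, ← h n, ih] at h1
    have h2 : ((n : ℂ) + 1) * cesaroA β (n + 1) = (n + 1 + β) * cesaroA β n := by
      exact_mod_cast congrArg (fun x : ℝ => (x : ℂ)) (cesaroA_succ hβ n)
    have h3 : (n.factorial : ℂ) ≠ 0 := by exact_mod_cast n.factorial_ne_zero
    have h4 : ((n : ℂ) + 1) ≠ 0 := by exact_mod_cast n.succ_ne_zero
    push_cast [Nat.factorial_succ] at h1
    apply mul_left_cancel₀ (mul_ne_zero h4 h3)
    linear_combination h1 - n.factorial * h2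

/-- The formal power series `p` converges absolutely on the open unit disc with sum `f`. -/
def HasDiscSum (p : PowerSeries ℂ) (f : ℂ → ℂ) : Prop :=
  ∀ z : ℂ, ‖z‖ < 1 → (Summable fun n => ‖PowerSeries.coeff n p * z ^ n‖) ∧
    ∑' n, PowerSeries.coeff n p * z ^ n = f z

theorem HasDiscSum.mul {p q : PowerSeries ℂ} {f g : ℂ → ℂ} (hp : HasDiscSum p f)
    (hq : HasDiscSum q g) : HasDiscSum (p * q) (fun z => f z * g z) := by
  intro z hz
  obtain ⟨sp, ep⟩ := hp z hz
  obtain ⟨sq, eq⟩ := hq z hz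
  have h : ∀ n, ∑ kl ∈ Finset.HasAntidiagonal.antidiagonal n,
      (PowerSeries.coeff kl.1 p * z ^ kl.1) *
      (PowerSeries.coeff kl.2 q * z ^ kl.2) = PowerSeries.coeff n (p * q) * z ^ n := by
    intro n
    rw [PowerSeries.coeff_mul, Finset.sum_mul]
    refine Finset.sum_congr rfl fun kl hkl => ?_
    rw [← Finset.HasAntidiagonal.mem_antidiagonal.1 hkl, pow_add]
    ring
  constructor
  · have := summable_norm_sum_mul_antidiagonal_of_summable_norm sp sq
    simpa only [h] using this
  · have := tsum_mul_tsum_eq_tsum_sum_antidiagonal_of_summable_norm sp sq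
    rw [ep, eq] at this
    simpa only [h] using this.symm

theorem hasDiscSum_one_add_X : HasDiscSum (1 + PowerSeries.X) (fun z => 1 + z) := by
  intro z _
  have h : ∀ n ∉ Finset.range 2, PowerSeries.coeff n (1 + PowerSeries.X : PowerSeries ℂ) * z ^ n =
      0 := by
    intro n hn
    have h1 : n ≠ 0 := by rintro rfl; simp at hn
    have h2 : n ≠ 1 := by rintro rfl; simp at hn
    simp [PowerSeries.coeff_one, PowerSeries.coeff_X, h1, h2]
  constructor
  · exact summable_of_ne_finset_zero (s := Finset.range 2) fun n hn => by rw [h n hn, norm_zero]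
  · rw [tsum_eq_sum h]
    simp [Finset.sum_range_succ, PowerSeries.coeff_one, PowerSeries.coeff_X]

theorem hasDiscSum_cesaroSeries {β : ℝ} (hβ : -1 < β) {u : ℂ} (hu : ‖u‖ ≤ 1) :
    HasDiscSum (cesaroSeries β u) (fun z => 1 / (1 - z * u) ^ (((β + 1 : ℝ)) : ℂ)) := by
  intro z hz
  have hzu : ‖z * u‖ < 1 := by
    rw [norm_mul]
    exact (mul_le_of_le_one_right (norm_nonneg z) hu).trans_lt hz
  have hF := Complex.one_div_one_sub_cpow_hasFPowerSeriesOnBall_zero (((β + 1 : ℝ)) : ℂ)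
  have hmem : z * u ∈ Metric.eball (0 : ℂ) 1 := by
    rw [Metric.mem_eball, edist_zero_right, ← ofReal_norm]
    exact ENNReal.ofReal_lt_one.2 hzu
  have hc : ∀ n, (FormalMultilinearSeries.ofScalars ℂ
      (fun n => Ring.choose ((((β + 1 : ℝ)) : ℂ) + n - 1) n) n) (fun _ => z * u) =
      PowerSeries.coeff n (cesaroSeries β u) * z ^ n := by
    intro n
    rw [FormalMultilinearSeries.ofScalars_apply_eq, ← Ring.multichoose_eq]
    push_cast
    rw [multichoose_eq_cesaroA hβ, cesaroSeries, PowerSeries.coeff_mk, smul_eq_mul]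
    ring
  constructor
  · have := FormalMultilinearSeries.summable_norm_apply _
      (Metric.eball_subset_eball hF.r_le hmem)
    simpa only [hc] using this
  · have := (hF.hasSum hmem).tsum_eq
    simpa only [hc, zero_add] using this

/-- Cauchy's estimate for the coefficients of a power series. -/
theorem HasDiscSum.norm_coeff_le {p : PowerSeries ℂ} {f : ℂ → ℂ} (hp : HasDiscSum p f) {ρ : ℝ}
    (hρ : 0 < ρ) (hρ1 : ρ < 1) (n : ℕ) :
    2 * π * (‖PowerSeries.coeff n p‖ * ρ ^ n) ≤ ∫ θ in (0)..2 * π, ‖f (circleMap 0 ρ θ)‖ := by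
  have hn : ∀ θ : ℝ, ‖circleMap 0 ρ θ‖ = ρ := fun θ => by
    simp [abs_of_pos hρ]
  have hsum : Summable fun m => ‖PowerSeries.coeff m p‖ * ρ ^ m := by
    have := (hp (ρ : ℂ) (by simpa [abs_of_pos hρ] using hρ1)).1
    simpa [abs_of_pos hρ] using this
  set e : ℤ → ℝ → ℂ := fun k θ => Complex.exp (k * Complex.I * θ) with he
  have he1 : ∀ k θ, ‖e k θ‖ = 1 := fun k θ => by
    rw [he]
    have : (k : ℂ) * Complex.I * θ = ((k * θ : ℝ) : ℂ) * Complex.I := by push_cast; ring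
    simp only
    rw [this, Complex.norm_exp_ofReal_mul_I]
  have hint : ∀ k : ℤ, ∫ θ in (0)..2 * π, e k θ = if k = 0 then 2 * π else 0 := by
    intro k
    split_ifs with hk
    · simp [he, hk]
    · have hk' : (k : ℂ) * Complex.I ≠ 0 := by simp [hk]
      rw [he]
      simp only
      rw [integral_exp_mul_complex hk']
      have : (k : ℂ) * Complex.I * ((2 * π : ℝ) : ℂ) = k * (2 * π * Complex.I) := by
        push_cast; ring
      rw [this, Complex.exp_int_mul_two_pi_mul_I]
      simp
  have hpow : ∀ (m : ℕ) (θ : ℝ), circleMap 0 ρ θ ^ m * e (-n) θ = ρ ^ m * e (m - n) θ := by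
    intro m θ
    rw [circleMap_zero, mul_pow, ← Complex.exp_nat_mul, he]
    simp only
    rw [mul_assoc, ← Complex.exp_add]
    congr 2
    push_cast
    ring
  have hS : HasSum (fun m => ∫ θ in (0)..2 * π, PowerSeries.coeff m p * (ρ ^ m * e (m - n) θ))
      (∫ θ in (0)..2 * π, f (circleMap 0 ρ θ) * e (-n) θ) := by
    refine intervalIntegral.hasSum_integral_of_dominated_convergence
      (fun m _ => ‖PowerSeries.coeff m p‖ * ρ ^ m) (fun m => ?_) (fun m => .of_forall fun θ _ => ?_)
      (.of_forall fun θ _ => hsum) (by simp) (.of_forall fun θ _ => ?_)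
    · refine Continuous.aestronglyMeasurable ?_
      simp only [he]
      fun_prop
    · rw [norm_mul, norm_mul, he1, mul_one, norm_pow, Complex.norm_real, Real.norm_eq_abs,
        abs_of_pos hρ]
    · obtain ⟨h1, h2⟩ := hp (circleMap 0 ρ θ) (by rw [hn]; exact hρ1)
      have := (h1.of_norm.hasSum.mul_right (e (-n) θ))
      rw [h2] at this
      simpa only [mul_assoc, hpow] using this
  have hval : ∫ θ in (0)..2 * π, f (circleMap 0 ρ θ) * e (-n) θ =
      PowerSeries.coeff n p * (ρ ^ n * (2 * π)) := by
    rw [← hS.tsum_eq, tsum_eq_single n]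
    · rw [intervalIntegral.integral_const_mul, intervalIntegral.integral_const_mul, hint]
      simp
    · intro m hm
      have : ((m : ℤ) - n) ≠ 0 := by omega
      rw [intervalIntegral.integral_const_mul, intervalIntegral.integral_const_mul, hint,
        if_neg this]
      simp
  have hle := intervalIntegral.norm_integral_le_integral_norm (μ := volume)
    (f := fun θ => f (circleMap 0 ρ θ) * e (-n) θ) (show (0 : ℝ) ≤ 2 * π by positivity)
  rw [hval] at hle
  simp only [norm_mul, he1, mul_one, norm_pow, Complex.norm_real, Real.norm_eq_abs, abs_of_pos hρ,
    Complex.norm_ofNat, abs_of_pos Real.pi_pos] at hle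
  linarith

/-- The Cesàro sums of Gegenbauer polynomials are bounded by circle integrals of the generating
function. -/
theorem abs_sum_cesaroA_mul_gegenbauer_le {l α : ℝ} (hl : 0 < l) (hα : 0 < α) {u : ℂ} (hu : ‖u‖ = 1)
    {ρ : ℝ} (hρ : 0 < ρ) (hρ1 : ρ < 1) (n : ℕ) :
    2 * π * (|∑ k ∈ Finset.range (n + 1), cesaroA α (n - k) * ((k + l) * gegenbauer l u.re k)| *
      ρ ^ n) ≤ l * ∫ θ in (0)..2 * π, ‖1 + circleMap 0 ρ θ‖ * (‖1 - circleMap 0 ρ θ‖ ^ (-α) *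
        (‖1 - circleMap 0 ρ θ * u‖ ^ (-(l + 1)) *
          ‖1 - circleMap 0 ρ θ * starRingEnd ℂ u‖ ^ (-(l + 1)))) := by
  have hD := hasDiscSum_one_add_X.mul ((hasDiscSum_cesaroSeries (show -1 < α - 1 by linarith)
    (u := 1) (by simp)).mul ((hasDiscSum_cesaroSeries (show -1 < l by linarith) hu.le).mul
      (hasDiscSum_cesaroSeries (show -1 < l by linarith) (u := starRingEnd ℂ u)
        (by rw [Complex.norm_conj, hu]))))
  have h := hD.norm_coeff_le hρ hρ1 n
  have e := congrArg norm (sum_cesaroA_mul_gegenbauer hl hα hu n)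
  rw [Complex.norm_real, Real.norm_eq_abs, norm_mul, Complex.norm_real, Real.norm_eq_abs,
    abs_of_pos hl] at e
  rw [e]
  have hnorm : ∀ (w : ℂ) (b : ℝ), ‖1 / w ^ (b : ℂ)‖ = ‖w‖ ^ (-b) := fun w b => by
    rw [norm_div, norm_one, Complex.norm_cpow_real, Real.rpow_neg (norm_nonneg _), one_div]
  simp only [norm_mul, hnorm, mul_one, sub_add_cancel] at h
  calc _ = l * (2 * π * (‖PowerSeries.coeff n ((1 + PowerSeries.X) * (cesaroSeries (α - 1) 1 *
        (cesaroSeries l u * cesaroSeries l (starRingEnd ℂ u))))‖ * ρ ^ n)) := by ring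
    _ ≤ _ := mul_le_mul_of_nonneg_left h hl.le

theorem add_abs_div_pi_le_norm_one_sub_circleMap {a θ : ℝ} (ha2 : a ≤ 1 / 2)
    (hθ : |θ| ≤ π) : (a + |θ|) / π ≤ ‖1 - circleMap 0 (1 - a) θ‖ := by
  have hπ := Real.pi_pos
  have hπ2 : 2 ≤ π := Real.two_le_pi
  have h1 : ‖1 - circleMap 0 (1 - a) θ‖ ^ 2 = a ^ 2 + 2 * (1 - a) * (1 - Real.cos θ) := by
    rw [← Complex.normSq_eq_norm_sq, Complex.normSq_apply, circleMap_zero]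
    simp only [Complex.sub_re, Complex.one_re, Complex.re_ofReal_mul, Complex.exp_ofReal_mul_I_re,
      Complex.sub_im, Complex.one_im, Complex.im_ofReal_mul, Complex.exp_ofReal_mul_I_im]
    linear_combination (1 - a) ^ 2 * Real.sin_sq_add_cos_sq θ
  have h2 := Real.cos_le_one_sub_mul_cos_sq hθ
  have h3 : ((a + |θ|) / π) ^ 2 ≤ ‖1 - circleMap 0 (1 - a) θ‖ ^ 2 := by
    rw [h1, div_pow, div_le_iff₀ (by positivity)]
    have h4 : 2 / π ^ 2 * θ ^ 2 ≤ 1 - Real.cos θ := by linarith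
    have h5 : 2 * θ ^ 2 ≤ (1 - Real.cos θ) * π ^ 2 := by
      calc 2 * θ ^ 2 = 2 / π ^ 2 * θ ^ 2 * π ^ 2 := by field_simp
        _ ≤ _ := by gcongr
    have h6 : 0 ≤ (1 - Real.cos θ) * π ^ 2 := by nlinarith
    have h7 : (4 : ℝ) ≤ π ^ 2 := by nlinarith
    have h8 : (a + |θ|) ^ 2 ≤ 2 * a ^ 2 + 2 * θ ^ 2 := by
      have := sq_abs θ
      nlinarith [sq_nonneg (a - |θ|)]
    nlinarith [mul_nonneg (sq_nonneg a) (show (0 : ℝ) ≤ π ^ 2 - 4 by linarith),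
      mul_nonneg (show (0 : ℝ) ≤ 1 / 2 - a by linarith) h6]
  exact le_of_sq_le_sq h3 (norm_nonneg _)

theorem le_norm_one_sub_circleMap_mul {a : ℝ} (ha1 : a ≤ 1) {v : ℂ} (hv : ‖v‖ = 1)
    (θ : ℝ) : a ≤ ‖1 - circleMap 0 (1 - a) θ * v‖ := by
  have h := norm_sub_norm_le (1 : ℂ) (circleMap 0 (1 - a) θ * v)
  rw [norm_one, norm_mul, hv, norm_circleMap_zero, abs_of_nonneg (by linarith)] at h
  linarith

theorem continuous_norm_one_sub_circleMap_rpow {a : ℝ} (ha : 0 < a) (ha1 : a ≤ 1) {v : ℂ}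
    (hv : ‖v‖ = 1) (p : ℝ) :
    Continuous fun θ : ℝ => ‖1 - circleMap 0 (1 - a) θ * v‖ ^ p :=
  Continuous.rpow_const (by fun_prop) fun θ =>
    Or.inl (ha.trans_le (le_norm_one_sub_circleMap_mul ha1 hv θ)).ne'

theorem integral_norm_one_sub_circleMap_rpow_le {a p : ℝ} (ha : 0 < a) (ha2 : a ≤ 1 / 2)
    (hp : 1 < p) {v : ℂ} (hv : ‖v‖ = 1) :
    ∫ θ in (0)..2 * π, ‖1 - circleMap 0 (1 - a) θ * v‖ ^ (-p) ≤
      2 * π ^ p / (p - 1) * a ^ (1 - p) := by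
  have hπ := Real.pi_pos
  have hcont := fun q => continuous_norm_one_sub_circleMap_rpow ha (by linarith)
    (norm_one (α := ℂ)) q
  simp only [mul_one] at hcont
  set F : ℝ → ℝ := fun θ => ‖1 - circleMap 0 (1 - a) θ‖ ^ (-p) with hF
  have hper : Function.Periodic F (2 * π) := fun θ => by
    simp only [hF, periodic_circleMap 0 (1 - a) θ]
  obtain ⟨ψ, hψ⟩ : ∃ ψ : ℝ, v = Complex.exp (ψ * Complex.I) :=
    ⟨v.arg, by simpa [hv] using (Complex.norm_mul_exp_arg_mul_I v).symm⟩
  have h1 : ∀ θ, ‖1 - circleMap 0 (1 - a) θ * v‖ ^ (-p) = F (θ + ψ) := by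
    intro θ
    simp only [hF, circleMap_zero, hψ]
    rw [mul_assoc, ← Complex.exp_add]
    push_cast
    ring_nf
  simp only [h1]
  rw [intervalIntegral.integral_comp_add_right, zero_add,
    show 2 * π + ψ = ψ + 2 * π by ring, hper.intervalIntegral_add_eq ψ (-π),
    show -π + 2 * π = π by ring]
  have hbc : ContinuousOn (fun θ : ℝ => ((a + |θ|) / π) ^ (-p)) Set.univ := by
    refine (Continuous.rpow_const (by fun_prop) fun θ => Or.inl ?_).continuousOn
    positivity
  rw [continuousOn_univ] at hbc
  have hlow : ∫ θ in (0)..π, ((a + θ) / π) ^ (-p) ≤ π ^ p / (p - 1) * a ^ (1 - p) := by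
    have e : ∀ θ ∈ Set.uIcc 0 π, ((a + θ) / π) ^ (-p) = π ^ p * (a + θ) ^ (-p) := by
      intro θ hθ
      rw [Set.uIcc_of_le hπ.le] at hθ
      rw [Real.div_rpow (by linarith [hθ.1]) hπ.le, Real.rpow_neg hπ.le, div_inv_eq_mul, mul_comm]
    rw [intervalIntegral.integral_congr e, intervalIntegral.integral_const_mul,
      intervalIntegral.integral_comp_add_left (fun x => x ^ (-p)), add_zero,
      integral_rpow (Or.inr ⟨by linarith, by
        rw [Set.uIcc_of_le (by linarith)]; exact fun h => absurd h.1 (by linarith)⟩)]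
    have : 0 ≤ (a + π) ^ (1 - p) := by positivity
    have hp' : 0 < p - 1 := by linarith
    rw [show -p + 1 = -(p - 1) by ring, div_neg, ← neg_div, show -(p - 1) = 1 - p by ring,
      div_mul_eq_mul_div, mul_div_assoc]
    gcongr
    linarith
  calc ∫ θ in (-π)..π, F θ ≤ ∫ θ in (-π)..π, ((a + |θ|) / π) ^ (-p) := by
        refine intervalIntegral.integral_mono_on (by linarith) ((hcont _).intervalIntegrable _ _)
          (hbc.intervalIntegrable _ _) fun θ hθ => ?_
        exact Real.rpow_le_rpow_of_nonpos (by positivity)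
          (add_abs_div_pi_le_norm_one_sub_circleMap ha2 (abs_le.2 hθ)) (by linarith)
    _ = 2 * ∫ θ in (0)..π, ((a + θ) / π) ^ (-p) := by
        rw [← intervalIntegral.integral_add_adjacent_intervals (b := 0)
          (hbc.intervalIntegrable _ _) (hbc.intervalIntegrable _ _)]
        have e1 : ∫ θ in (-π)..0, ((a + |θ|) / π) ^ (-p) =
            ∫ θ in (0)..π, ((a + |θ|) / π) ^ (-p) := by
          have := intervalIntegral.integral_comp_neg (a := 0) (b := π)
            (fun θ => ((a + |θ|) / π) ^ (-p))
          simpa using this.symm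
        rw [e1, ← two_mul]
        congr 1
        refine intervalIntegral.integral_congr fun θ hθ => ?_
        rw [Set.uIcc_of_le hπ.le] at hθ
        simp only [abs_of_nonneg hθ.1]
    _ ≤ 2 * (π ^ p / (p - 1) * a ^ (1 - p)) := by gcongr
    _ = _ := by ring

theorem rpow_neg_mul_rpow_neg_le {A D s α μ : ℝ} (hA : 0 < A) (hD : 0 < D) (hs : 0 < s)
    (hα : 0 < α) (hμ : 1 / 2 < μ) (h : s ≤ max D A) :
    D ^ (-α) * A ^ (-μ) ≤ s ^ (-α) * A ^ (-μ) + s ^ (1 / 2 - μ) * D ^ (-(α + 1 / 2)) := by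
  rcases le_or_gt s D with hsD | hDs
  · have h1 : D ^ (-α) ≤ s ^ (-α) := Real.rpow_le_rpow_of_nonpos hs hsD (by linarith)
    have h2 : 0 ≤ s ^ (1 / 2 - μ) * D ^ (-(α + 1 / 2)) := by positivity
    have h3 : D ^ (-α) * A ^ (-μ) ≤ s ^ (-α) * A ^ (-μ) := by gcongr
    linarith
  · have hsA : s ≤ A := by
      rcases le_max_iff.1 h with h | h
      · exact absurd h (not_le.2 hDs)
      · exact h
    have h1 : A ^ (-μ) ≤ s ^ (-μ) := Real.rpow_le_rpow_of_nonpos hs hsA (by linarith)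
    have h2 : 0 ≤ s ^ (-α) * A ^ (-μ) := by positivity
    have h3 : s ^ (-(1 / 2 : ℝ)) ≤ D ^ (-(1 / 2 : ℝ)) :=
      Real.rpow_le_rpow_of_nonpos hD hDs.le (by norm_num)
    have h4 : D ^ (-α) * s ^ (-μ) = s ^ (1 / 2 - μ) * (D ^ (-α) * s ^ (-(1 / 2 : ℝ))) := by
      rw [mul_left_comm, ← Real.rpow_add hs]
      ring_nf
    have h5 : D ^ (-(α + 1 / 2)) = D ^ (-α) * D ^ (-(1 / 2 : ℝ)) := by
      rw [← Real.rpow_add hD]; ring_nf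
    calc D ^ (-α) * A ^ (-μ) ≤ D ^ (-α) * s ^ (-μ) := by gcongr
      _ ≤ s ^ (1 / 2 - μ) * D ^ (-(α + 1 / 2)) := by rw [h4, h5]; gcongr
      _ ≤ _ := by linarith

theorem rpow_neg_mul_rpow_neg_self_le {A B e μ : ℝ} (hA : 0 < A) (hB : 0 < B) (he : 0 < e)
    (hμ : 0 < μ) (h : e ≤ max A B) :
    A ^ (-μ) * B ^ (-μ) ≤ e ^ (-μ) * (A ^ (-μ) + B ^ (-μ)) := by
  have hA' : 0 < A ^ (-μ) := by positivity
  have hB' : 0 < B ^ (-μ) := by positivity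
  have he' : 0 < e ^ (-μ) := by positivity
  rcases le_max_iff.1 h with h | h
  · have : A ^ (-μ) ≤ e ^ (-μ) := Real.rpow_le_rpow_of_nonpos he h (by linarith)
    nlinarith [mul_le_mul_of_nonneg_right this hB'.le, mul_pos he' hA']
  · have : B ^ (-μ) ≤ e ^ (-μ) := Real.rpow_le_rpow_of_nonpos he h (by linarith)
    nlinarith [mul_le_mul_of_nonneg_left this hA'.le, mul_pos he' hB']

theorem norm_sub_div_four_le_max {a : ℝ} (ha2 : a ≤ 1 / 2) (v w : ℂ)
    (θ : ℝ) : ‖v - w‖ / 4 ≤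
      max ‖1 - circleMap 0 (1 - a) θ * v‖ ‖1 - circleMap 0 (1 - a) θ * w‖ := by
  set z := circleMap 0 (1 - a) θ with hz
  have h0 : ‖z‖ = 1 - a := by rw [hz, norm_circleMap_zero, abs_of_nonneg (by linarith)]
  have h1 : ‖z * (v - w)‖ ≤ ‖1 - z * v‖ + ‖1 - z * w‖ := by
    have := norm_sub_le (1 - z * w) (1 - z * v)
    rw [show 1 - z * w - (1 - z * v) = z * (v - w) by ring] at this
    linarith
  rw [norm_mul, h0] at h1
  have h2 : 1 / 2 * ‖v - w‖ ≤ (1 - a) * ‖v - w‖ := by gcongr; linarith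
  have h3 := le_max_left ‖1 - z * v‖ ‖1 - z * w‖
  have h4 := le_max_right ‖1 - z * v‖ ‖1 - z * w‖
  linarith

theorem norm_one_add_circleMap_le {a : ℝ} (ha : 0 ≤ a) (ha2 : a ≤ 1 / 2) (θ : ℝ) :
    ‖1 + circleMap 0 (1 - a) θ‖ ≤ 2 := by
  have h := norm_add_le (1 : ℂ) (circleMap 0 (1 - a) θ)
  rw [norm_one, norm_circleMap_zero, abs_of_nonneg (by linarith)] at h
  linarith

theorem integral_generating_le {a α μ : ℝ} (ha : 0 < a) (ha2 : a ≤ 1 / 2) (hα : 0 < α)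
    (hμ : 1 < μ) {u : ℂ} (hu : ‖u‖ = 1) :
    ∫ θ in (0)..2 * π, ‖1 + circleMap 0 (1 - a) θ‖ * (‖1 - circleMap 0 (1 - a) θ‖ ^ (-α) *
        (‖1 - circleMap 0 (1 - a) θ * u‖ ^ (-μ) *
          ‖1 - circleMap 0 (1 - a) θ * starRingEnd ℂ u‖ ^ (-μ))) ≤
      4 * π ^ μ / (μ - 1) * a ^ (1 - α - 2 * μ) := by
  have hu' : ‖starRingEnd ℂ u‖ = 1 := by rw [Complex.norm_conj, hu]
  have ha1 : a ≤ 1 := by linarith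
  have c1 := continuous_norm_one_sub_circleMap_rpow ha ha1 (norm_one (α := ℂ)) (-α)
  have c2 := continuous_norm_one_sub_circleMap_rpow ha ha1 hu (-μ)
  have c3 := continuous_norm_one_sub_circleMap_rpow ha ha1 hu' (-μ)
  have c0 : Continuous fun θ => ‖1 + circleMap 0 (1 - a) θ‖ := by fun_prop
  simp only [mul_one] at c1
  have hpt : ∀ θ, ‖1 + circleMap 0 (1 - a) θ‖ * (‖1 - circleMap 0 (1 - a) θ‖ ^ (-α) *
        (‖1 - circleMap 0 (1 - a) θ * u‖ ^ (-μ) *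
          ‖1 - circleMap 0 (1 - a) θ * starRingEnd ℂ u‖ ^ (-μ))) ≤
      2 * a ^ (-α) * a ^ (-μ) * ‖1 - circleMap 0 (1 - a) θ * u‖ ^ (-μ) := by
    intro θ
    have h1 := norm_one_add_circleMap_le ha.le ha2 θ
    have h2 := le_norm_one_sub_circleMap_mul ha1 (norm_one (α := ℂ)) θ
    rw [mul_one] at h2
    have h3 := le_norm_one_sub_circleMap_mul ha1 hu' θ
    have h4 : ‖1 - circleMap 0 (1 - a) θ‖ ^ (-α) ≤ a ^ (-α) :=
      Real.rpow_le_rpow_of_nonpos ha h2 (by linarith)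
    have h5 : ‖1 - circleMap 0 (1 - a) θ * starRingEnd ℂ u‖ ^ (-μ) ≤ a ^ (-μ) :=
      Real.rpow_le_rpow_of_nonpos ha h3 (by linarith)
    calc _ ≤ 2 * (a ^ (-α) * (‖1 - circleMap 0 (1 - a) θ * u‖ ^ (-μ) * a ^ (-μ))) := by gcongr
      _ = _ := by ring
  calc _ ≤ ∫ θ in (0)..2 * π, 2 * a ^ (-α) * a ^ (-μ) * ‖1 - circleMap 0 (1 - a) θ * u‖ ^ (-μ) :=
        intervalIntegral.integral_mono_on (by positivity)
          ((c0.mul (c1.mul (c2.mul c3))).intervalIntegrable _ _)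
          ((continuous_const.mul c2).intervalIntegrable _ _) fun θ _ => hpt θ
    _ ≤ 2 * a ^ (-α) * a ^ (-μ) * (2 * π ^ μ / (μ - 1) * a ^ (1 - μ)) := by
        rw [intervalIntegral.integral_const_mul]
        gcongr
        exact integral_norm_one_sub_circleMap_rpow_le ha ha2 hμ hu
    _ = 4 * π ^ μ / (μ - 1) * (a ^ (-α) * a ^ (-μ) * a ^ (1 - μ)) := by ring
    _ = _ := by
        rw [← Real.rpow_add ha, ← Real.rpow_add ha]
        ring_nf

theorem exists_integral_generating_le_mul {α μ : ℝ} (hα : 1 / 2 < α) (hμ : 1 < μ) :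
    ∃ C : ℝ, 0 < C ∧ ∀ (a : ℝ) (u : ℂ), 0 < a → a ≤ 1 / 2 → ‖u‖ = 1 →
      u - starRingEnd ℂ u ≠ 0 → 1 - u ≠ 0 →
    ∫ θ in (0)..2 * π, ‖1 + circleMap 0 (1 - a) θ‖ * (‖1 - circleMap 0 (1 - a) θ‖ ^ (-α) *
        (‖1 - circleMap 0 (1 - a) θ * u‖ ^ (-μ) *
          ‖1 - circleMap 0 (1 - a) θ * starRingEnd ℂ u‖ ^ (-μ))) ≤
      C * (‖u - starRingEnd ℂ u‖ ^ (-μ) * (‖1 - u‖ ^ (-α) * a ^ (1 - μ) +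
        ‖1 - u‖ ^ (1 / 2 - μ) * a ^ (1 / 2 - α))) := by
  set C₁ := 2 * π ^ μ / (μ - 1) with hC₁
  set C₂ := 2 * π ^ (α + 1 / 2) / (α + 1 / 2 - 1) with hC₂
  have hπ := Real.pi_pos
  have hC₁p : 0 < C₁ := by have : 0 < μ - 1 := by linarith
                           positivity
  have hC₂p : 0 < C₂ := by have : 0 < α + 1 / 2 - 1 := by linarith
                           positivity
  have h4 : ∀ x : ℝ, (0 : ℝ) < 4 ^ x := fun x => by positivity
  refine ⟨2 * 4 ^ μ * (2 * 4 ^ α * C₁ + 2 * 4 ^ (μ - 1 / 2) * C₂), by positivity, ?_⟩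
  intro a u ha ha2 hu hu1 hu2
  have hu' : ‖starRingEnd ℂ u‖ = 1 := by rw [Complex.norm_conj, hu]
  have ha1 : a ≤ 1 := by linarith
  have c1 := fun p => continuous_norm_one_sub_circleMap_rpow ha ha1 (norm_one (α := ℂ)) p
  have c2 := continuous_norm_one_sub_circleMap_rpow ha ha1 hu (-μ)
  have c3 := continuous_norm_one_sub_circleMap_rpow ha ha1 hu' (-μ)
  have c0 : Continuous fun θ => ‖1 + circleMap 0 (1 - a) θ‖ := by fun_prop
  simp only [mul_one] at c1
  set e := ‖u - starRingEnd ℂ u‖ / 4 with he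
  set s := ‖1 - u‖ / 4 with hs
  have hep : 0 < e := by have := norm_pos_iff.2 hu1
                         positivity
  have hsp : 0 < s := by have := norm_pos_iff.2 hu2
                         positivity
  have hs' : ‖1 - starRingEnd ℂ u‖ / 4 = s := by
    rw [hs, ← Complex.norm_conj (1 - u), map_sub, map_one]
  set z : ℝ → ℂ := fun θ => circleMap 0 (1 - a) θ with hz
  have hpt : ∀ θ, ‖1 + z θ‖ * (‖1 - z θ‖ ^ (-α) *
        (‖1 - z θ * u‖ ^ (-μ) * ‖1 - z θ * starRingEnd ℂ u‖ ^ (-μ))) ≤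
      2 * e ^ (-μ) * s ^ (-α) * ‖1 - z θ * u‖ ^ (-μ) +
      2 * e ^ (-μ) * s ^ (-α) * ‖1 - z θ * starRingEnd ℂ u‖ ^ (-μ) +
      4 * e ^ (-μ) * s ^ (1 / 2 - μ) * ‖1 - z θ‖ ^ (-(α + 1 / 2)) := by
    intro θ
    have h1 := norm_one_add_circleMap_le ha.le ha2 θ
    have hD := ha.trans_le (le_norm_one_sub_circleMap_mul ha1 (norm_one (α := ℂ)) θ)
    have hA := ha.trans_le (le_norm_one_sub_circleMap_mul ha1 hu θ)
    have hB := ha.trans_le (le_norm_one_sub_circleMap_mul ha1 hu' θ)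
    have m1 := norm_sub_div_four_le_max ha2 u (starRingEnd ℂ u) θ
    have m2 := norm_sub_div_four_le_max ha2 1 u θ
    have m3 := norm_sub_div_four_le_max ha2 1 (starRingEnd ℂ u) θ
    rw [mul_one] at m2 m3 hD
    rw [hs'] at m3
    have k1 := rpow_neg_mul_rpow_neg_self_le (μ := μ) hA hB hep (by linarith) m1
    have k2 := rpow_neg_mul_rpow_neg_le (μ := μ) hA hD hsp (by linarith : 0 < α) (by linarith) m2
    have k3 := rpow_neg_mul_rpow_neg_le (μ := μ) hB hD hsp (by linarith : 0 < α) (by linarith) m3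
    have hep' : 0 < e ^ (-μ) := by positivity
    calc _ ≤ 2 * (‖1 - z θ‖ ^ (-α) * (e ^ (-μ) * (‖1 - z θ * u‖ ^ (-μ) +
          ‖1 - z θ * starRingEnd ℂ u‖ ^ (-μ)))) := by gcongr
      _ = 2 * e ^ (-μ) * (‖1 - z θ‖ ^ (-α) * ‖1 - z θ * u‖ ^ (-μ) +
          ‖1 - z θ‖ ^ (-α) * ‖1 - z θ * starRingEnd ℂ u‖ ^ (-μ)) := by ring
      _ ≤ 2 * e ^ (-μ) * ((s ^ (-α) * ‖1 - z θ * u‖ ^ (-μ) +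
          s ^ (1 / 2 - μ) * ‖1 - z θ‖ ^ (-(α + 1 / 2))) +
          (s ^ (-α) * ‖1 - z θ * starRingEnd ℂ u‖ ^ (-μ) +
          s ^ (1 / 2 - μ) * ‖1 - z θ‖ ^ (-(α + 1 / 2)))) := by
        exact mul_le_mul_of_nonneg_left (add_le_add k2 k3) (by positivity)
      _ = _ := by ring
  have i2 := (c2.const_mul (2 * e ^ (-μ) * s ^ (-α))).intervalIntegrable (μ := volume) 0 (2 * π)
  have i3 := (c3.const_mul (2 * e ^ (-μ) * s ^ (-α))).intervalIntegrable (μ := volume) 0 (2 * π)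
  have i1 := ((c1 (-(α + 1 / 2))).const_mul
    (4 * e ^ (-μ) * s ^ (1 / 2 - μ))).intervalIntegrable (μ := volume) 0 (2 * π)
  have j1 := integral_norm_one_sub_circleMap_rpow_le ha ha2 hμ hu
  have j2 := integral_norm_one_sub_circleMap_rpow_le ha ha2 hμ hu'
  have j3 := integral_norm_one_sub_circleMap_rpow_le ha ha2 (show 1 < α + 1 / 2 by linarith)
    (norm_one (α := ℂ))
  simp only [mul_one] at j3
  calc _ ≤ ∫ θ in (0)..2 * π, (2 * e ^ (-μ) * s ^ (-α) * ‖1 - z θ * u‖ ^ (-μ) +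
      2 * e ^ (-μ) * s ^ (-α) * ‖1 - z θ * starRingEnd ℂ u‖ ^ (-μ) +
      4 * e ^ (-μ) * s ^ (1 / 2 - μ) * ‖1 - z θ‖ ^ (-(α + 1 / 2))) :=
        intervalIntegral.integral_mono_on (by positivity)
          ((c0.mul ((c1 _).mul (c2.mul c3))).intervalIntegrable _ _)
          ((i2.add i3).add i1) fun θ _ => hpt θ
    _ ≤ 2 * e ^ (-μ) * s ^ (-α) * (C₁ * a ^ (1 - μ)) +
        2 * e ^ (-μ) * s ^ (-α) * (C₁ * a ^ (1 - μ)) +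
        4 * e ^ (-μ) * s ^ (1 / 2 - μ) * (C₂ * a ^ (1 - (α + 1 / 2))) := by
        rw [intervalIntegral.integral_add (i2.add i3) i1, intervalIntegral.integral_add i2 i3,
          intervalIntegral.integral_const_mul, intervalIntegral.integral_const_mul,
          intervalIntegral.integral_const_mul]
        gcongr
    _ = 2 * e ^ (-μ) * (2 * s ^ (-α) * C₁ * a ^ (1 - μ) +
        2 * s ^ (1 / 2 - μ) * C₂ * a ^ (1 / 2 - α)) := by
        rw [show 1 - (α + 1 / 2) = 1 / 2 - α by ring]
        ring
    _ = 2 * 4 ^ μ * ‖u - starRingEnd ℂ u‖ ^ (-μ) * (2 * (4 ^ α * ‖1 - u‖ ^ (-α)) * C₁ *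
          a ^ (1 - μ) +
        2 * (4 ^ (μ - 1 / 2) * ‖1 - u‖ ^ (1 / 2 - μ)) * C₂ * a ^ (1 / 2 - α)) := by
        have q : ∀ (x p : ℝ), 0 ≤ x → (x / 4) ^ p = 4 ^ (-p) * x ^ p := fun x p hx => by
          rw [Real.div_rpow hx (by norm_num), Real.rpow_neg (by norm_num), div_eq_mul_inv, mul_comm]
        rw [he, hs, q _ _ (norm_nonneg _), q _ _ (norm_nonneg _), q _ _ (norm_nonneg _)]
        simp only [neg_neg, neg_sub]
        ring
    _ ≤ _ := by
        have t1 : 0 ≤ ‖u - starRingEnd ℂ u‖ ^ (-μ) := by positivity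
        have t2 : 0 ≤ ‖1 - u‖ ^ (-α) * a ^ (1 - μ) := by positivity
        have t3 : 0 ≤ ‖1 - u‖ ^ (1 / 2 - μ) * a ^ (1 / 2 - α) := by positivity
        rw [← sub_nonneg]
        have : 0 ≤ 2 * 4 ^ μ * ‖u - starRingEnd ℂ u‖ ^ (-μ) *
          (2 * 4 ^ (μ - 1 / 2) * C₂ * (‖1 - u‖ ^ (-α) * a ^ (1 - μ)) +
            2 * 4 ^ α * C₁ * (‖1 - u‖ ^ (1 / 2 - μ) * a ^ (1 / 2 - α))) := by positivity
        refine this.trans_eq ?_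
        ring

theorem eventually_inv_cesaroA_le {α : ℝ} (hα : 0 < α) :
    ∃ C : ℝ, 0 < C ∧ ∀ᶠ n : ℕ in atTop, (cesaroA α n)⁻¹ ≤ C * (((n : ℝ) + 1)⁻¹) ^ α := by
  have hΓ := Real.Gamma_pos_of_pos hα
  refine ⟨α * (Real.Gamma α + 1) * 2 ^ α, by positivity, ?_⟩
  have hprod : ∀ n : ℕ, Real.Gamma α * ∏ j ∈ Finset.range (n + 1), (α + j) =
      Real.Gamma (α + n + 1) := by
    intro n
    induction n with
    | zero => simp [Real.Gamma_add_one hα.ne', mul_comm]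
    | succ n ih =>
      rw [Finset.prod_range_succ, ← mul_assoc, ih]
      have : α + ((n + 1 : ℕ) : ℝ) = α + n + 1 := by push_cast; ring
      rw [this, Real.Gamma_add_one (s := α + n + 1) (by positivity), mul_comm]
  filter_upwards [(Real.GammaSeq_tendsto_Gamma α).eventually_lt_const
    (show Real.Gamma α < Real.Gamma α + 1 by linarith), eventually_ge_atTop 1] with n hn hn1
  have hn0 : (0 : ℝ) < n := by exact_mod_cast hn1
  have hp : 0 < ∏ j ∈ Finset.range (n + 1), (α + (j : ℝ)) :=
    Finset.prod_pos fun j _ => by positivity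
  have hnα : 0 < (n : ℝ) ^ α := by positivity
  have e : (cesaroA α n)⁻¹ = α * Real.GammaSeq α n * ((n : ℝ)⁻¹) ^ α := by
    rw [cesaroA, ← hprod, Real.Gamma_add_one hα.ne', Real.GammaSeq, Real.inv_rpow hn0.le]
    field_simp
  rw [e]
  have h1 : ((n : ℝ)⁻¹) ^ α ≤ 2 ^ α * (((n : ℝ) + 1)⁻¹) ^ α := by
    rw [← Real.mul_rpow (by norm_num) (by positivity)]
    refine Real.rpow_le_rpow (by positivity) ?_ hα.le
    rw [inv_le_iff_one_le_mul₀ hn0, mul_assoc, mul_comm _ (n : ℝ), ← mul_assoc, ← div_eq_mul_inv,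
      one_le_div (by positivity)]
    have : (1 : ℝ) ≤ n := by exact_mod_cast hn1
    linarith
  calc _ ≤ α * (Real.Gamma α + 1) * (2 ^ α * (((n : ℝ) + 1)⁻¹) ^ α) := by gcongr
    _ = _ := by ring

theorem one_le_exp_mul_one_sub_inv_pow {n : ℕ} (hn : 1 ≤ n) :
    1 ≤ Real.exp 1 * (1 - ((n : ℝ) + 1)⁻¹) ^ n := by
  have hn0 : (0 : ℝ) < n := by exact_mod_cast hn
  have h1 : (1 - ((n : ℝ) + 1)⁻¹) = (1 + (n : ℝ)⁻¹)⁻¹ := by field_simp; ring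
  have h2 : 1 + (n : ℝ)⁻¹ ≤ Real.exp (n : ℝ)⁻¹ := by
    have := Real.add_one_le_exp (n : ℝ)⁻¹
    linarith
  have h3 : (1 + (n : ℝ)⁻¹) ^ n ≤ Real.exp 1 := by
    calc _ ≤ Real.exp (n : ℝ)⁻¹ ^ n := by gcongr
      _ = _ := by rw [← Real.exp_nat_mul, mul_inv_cancel₀ hn0.ne']
  rw [h1, inv_pow, ← div_eq_mul_inv, one_le_div (by positivity)]
  exact h3

theorem sphMeasure_real_univ_pos (N : ℕ) : 0 < (sphMeasure N).real Set.univ := by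
  rw [sphMeasure, Measure.toSphere_real_apply_univ]
  have h1 : 0 < (volume : Measure (EuclideanSpace ℝ (Fin (N + 1)))).real (ball 0 1) :=
    ENNReal.toReal_pos (measure_ball_pos _ _ one_pos).ne' measure_ball_lt_top.ne
  have h2 : 0 < Module.finrank ℝ (EuclideanSpace ℝ (Fin (N + 1))) := by simp
  positivity

theorem IsFourierLaplaceBasis.exists_abs_cesaroKernel_le_integral {N : ℕ} {a : ℕ → ℕ}
    {Y : (k : ℕ) → Fin (a k) → Sph N → ℝ} (hY : IsFourierLaplaceBasis N a Y) {l α : ℝ}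
    (hl : 2 * l + 1 = N) (hl0 : 0 < l) (hα : 0 < α) :
    ∃ C : ℝ, 0 < C ∧ ∀ᶠ n : ℕ in atTop, ∀ (x y : Sph N) (u : ℂ), ‖u‖ = 1 →
      u.re = ⟪(x : EuclideanSpace ℝ (Fin (N + 1))), y⟫ →
      |cesaroKernel Y α n x y| ≤ C * ((((n : ℝ) + 1)⁻¹) ^ α *
        ∫ θ in (0)..2 * π, ‖1 + circleMap 0 (1 - ((n : ℝ) + 1)⁻¹) θ‖ *
          (‖1 - circleMap 0 (1 - ((n : ℝ) + 1)⁻¹) θ‖ ^ (-α) *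
        (‖1 - circleMap 0 (1 - ((n : ℝ) + 1)⁻¹) θ * u‖ ^ (-(l + 1)) *
          ‖1 - circleMap 0 (1 - ((n : ℝ) + 1)⁻¹) θ * starRingEnd ℂ u‖ ^ (-(l + 1))))) := by
  obtain ⟨C, hC, hA⟩ := eventually_inv_cesaroA_le hα
  set ω := (sphMeasure N).real Set.univ with hω
  have hω0 : 0 < ω := sphMeasure_real_univ_pos N
  have hπ := Real.pi_pos
  refine ⟨C * Real.exp 1 / (2 * π * ω), by positivity, ?_⟩
  filter_upwards [hA, eventually_ge_atTop 1] with n hn hn1 x y u hu hre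
  have hn0 : (1 : ℝ) ≤ n := by exact_mod_cast hn1
  set r := ((n : ℝ) + 1)⁻¹ with hr
  have hr0 : 0 < r := by positivity
  have hr1 : r ≤ 1 / 2 := by
    rw [hr, inv_le_comm₀ (by positivity) (by norm_num)]
    linarith
  have hA0 := cesaroA_pos (show -1 < α by linarith) n
  have hb := abs_sum_cesaroA_mul_gegenbauer_le hl0 hα hu (show 0 < 1 - r by linarith)
    (by linarith) n
  have hexp := one_le_exp_mul_one_sub_inv_pow hn1
  rw [← hr] at hexp
  set I := ∫ θ in (0)..2 * π, ‖1 + circleMap 0 (1 - r) θ‖ *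
          (‖1 - circleMap 0 (1 - r) θ‖ ^ (-α) *
        (‖1 - circleMap 0 (1 - r) θ * u‖ ^ (-(l + 1)) *
          ‖1 - circleMap 0 (1 - r) θ * starRingEnd ℂ u‖ ^ (-(l + 1)))) with hI
  set S := ∑ k ∈ Finset.range (n + 1), cesaroA α (n - k) * ((k + l) * gegenbauer l u.re k) with hS
  have hK : l * ω * cesaroKernel Y α n x y = (cesaroA α n)⁻¹ * S := by
    rw [cesaroKernel, mul_left_comm, Finset.mul_sum, hS]
    congr 1
    refine Finset.sum_congr rfl fun k _ => ?_
    rw [mul_left_comm, hY.sum_mul_eq hl hl0 k x y, hre]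
  have hI0 : 0 ≤ I := intervalIntegral.integral_nonneg (by positivity) fun θ _ => by positivity
  have hS1 : 2 * π * |S| ≤ Real.exp 1 * (l * I) := by
    calc 2 * π * |S| = 2 * π * |S| * 1 := by ring
      _ ≤ 2 * π * |S| * (Real.exp 1 * (1 - r) ^ n) := by gcongr
      _ = Real.exp 1 * (2 * π * (|S| * (1 - r) ^ n)) := by ring
      _ ≤ _ := by gcongr
  have hKabs : l * ω * |cesaroKernel Y α n x y| = (cesaroA α n)⁻¹ * |S| := by
    have := congrArg abs hK
    rwa [abs_mul, abs_of_pos (mul_pos hl0 hω0), abs_mul, abs_of_pos (inv_pos.2 hA0)] at this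
  rw [div_mul_eq_mul_div, le_div_iff₀ (by positivity)]
  have hfin : l * (|cesaroKernel Y α n x y| * (2 * π * ω)) ≤
      l * (C * Real.exp 1 * (r ^ α * I)) := by
    calc _ = 2 * π * (l * ω * |cesaroKernel Y α n x y|) := by ring
      _ = (cesaroA α n)⁻¹ * (2 * π * |S|) := by rw [hKabs]; ring
      _ ≤ (C * r ^ α) * (Real.exp 1 * (l * I)) := by gcongr
      _ = _ := by ring
  exact le_of_mul_le_mul_left hfin hl0

/-- Pointwise bounds for the Cesàro kernel above the critical order. -/
theorem IsFourierLaplaceBasis.exists_abs_cesaroKernel_le {N : ℕ} {a : ℕ → ℕ}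
    {Y : (k : ℕ) → Fin (a k) → Sph N → ℝ} (hY : IsFourierLaplaceBasis N a Y) {l α : ℝ}
    (hl : 2 * l + 1 = N) (hl0 : 1 / 2 ≤ l) (hα : l < α) :
    ∃ C ε : ℝ, 0 < C ∧ 0 < ε ∧ ∀ᶠ n : ℕ in atTop, ∀ x y : Sph N,
      |cesaroKernel Y α n x y| ≤ C * ((n : ℝ) + 1) ^ N ∧
      (0 < ‖(x + y : EuclideanSpace ℝ (Fin (N + 1)))‖ →
        ((n : ℝ) + 1)⁻¹ ≤ ‖(x - y : EuclideanSpace ℝ (Fin (N + 1)))‖ →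
        |cesaroKernel Y α n x y| ≤ C * ((((n : ℝ) + 1)⁻¹) ^ ε *
          (‖(x + y : EuclideanSpace ℝ (Fin (N + 1)))‖ ^ (-(l + 1)) *
            ‖(x - y : EuclideanSpace ℝ (Fin (N + 1)))‖ ^ (-(N + ε))))) := by
  obtain ⟨C₀, hC₀, hK⟩ := hY.exists_abs_cesaroKernel_le_integral hl (by linarith : 0 < l)
    (by linarith : 0 < α)
  obtain ⟨C₂, hC₂, hI₂⟩ := exists_integral_generating_le_mul (show 1 / 2 < α by linarith)
    (show 1 < l + 1 by linarith)
  set C₁ := 4 * π ^ (l + 1) / (l + 1 - 1) with hC₁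
  have hπ := Real.pi_pos
  have hC₁0 : 0 < C₁ := by
    have : 0 < l + 1 - 1 := by linarith
    positivity
  set ε := min (α - l) (1 / 2) with hε
  refine ⟨max (C₀ * C₁) (2 * (C₀ * C₂)), ε, by positivity,
    lt_min (by linarith) (by norm_num), ?_⟩
  filter_upwards [hK, eventually_ge_atTop 1] with n hn hn1 x y
  have hn0 : (1 : ℝ) ≤ n := by exact_mod_cast hn1
  set r := ((n : ℝ) + 1)⁻¹ with hr
  have hr0 : 0 < r := by positivity
  have hr1 : r ≤ 1 / 2 := by
    rw [hr, inv_le_comm₀ (by positivity) (by norm_num)]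
    linarith
  set t := ⟪(x : EuclideanSpace ℝ (Fin (N + 1))), (y : EuclideanSpace ℝ (Fin (N + 1)))⟫ with ht
  have hx1 : ‖(x : EuclideanSpace ℝ (Fin (N + 1)))‖ = 1 := by simp
  have hy1 : ‖(y : EuclideanSpace ℝ (Fin (N + 1)))‖ = 1 := by simp
  have hd : ‖(x - y : EuclideanSpace ℝ (Fin (N + 1)))‖ ^ 2 = 2 - 2 * t := by
    rw [norm_sub_sq_real, hx1, hy1]; ring
  have hd' : ‖(x + y : EuclideanSpace ℝ (Fin (N + 1)))‖ ^ 2 = 2 + 2 * t := by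
    rw [norm_add_sq_real, hx1, hy1]; ring
  set d := ‖(x - y : EuclideanSpace ℝ (Fin (N + 1)))‖ with hdd
  set d' := ‖(x + y : EuclideanSpace ℝ (Fin (N + 1)))‖ with hdd'
  have ht2 : 0 ≤ 1 - t ^ 2 := by nlinarith [mul_nonneg (sq_nonneg d) (sq_nonneg d')]
  set u : ℂ := ⟨t, √(1 - t ^ 2)⟩ with hu
  have hsq := Real.sq_sqrt ht2
  have hu1 : ‖u‖ = 1 := by
    have : ‖u‖ ^ 2 = 1 ^ 2 := by
      rw [← Complex.normSq_eq_norm_sq, Complex.normSq_apply, hu]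
      simp only
      linear_combination hsq
    exact (sq_eq_sq₀ (norm_nonneg _) zero_le_one).1 this
  have hud : ‖1 - u‖ = d := by
    have : ‖1 - u‖ ^ 2 = d ^ 2 := by
      rw [← Complex.normSq_eq_norm_sq, Complex.normSq_apply, hu, hd]
      simp only [Complex.sub_re, Complex.one_re, Complex.sub_im, Complex.one_im]
      linear_combination hsq
    exact (sq_eq_sq₀ (norm_nonneg _) (norm_nonneg _)).1 this
  have huu : ‖u - starRingEnd ℂ u‖ = d * d' := by
    have : ‖u - starRingEnd ℂ u‖ ^ 2 = (d * d') ^ 2 := by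
      rw [← Complex.normSq_eq_norm_sq, Complex.normSq_apply, hu, mul_pow, hd, hd']
      simp only [Complex.sub_re, Complex.conj_re, Complex.sub_im, Complex.conj_im]
      linear_combination 4 * hsq
    exact (sq_eq_sq₀ (norm_nonneg _) (by positivity)).1 this
  have hk := hn x y u hu1 rfl
  constructor
  · refine hk.trans ?_
    calc _ ≤ C₀ * (r ^ α * (C₁ * r ^ (1 - α - 2 * (l + 1)))) := by
          gcongr
          exact integral_generating_le hr0 hr1 (by linarith) (by linarith) hu1
      _ = C₀ * C₁ * (r ^ α * r ^ (1 - α - 2 * (l + 1))) := by ring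
      _ = C₀ * C₁ * ((n : ℝ) + 1) ^ N := by
          rw [← Real.rpow_add hr0, show α + (1 - α - 2 * (l + 1)) = -(N : ℝ) by linarith,
            Real.rpow_neg hr0.le, Real.rpow_natCast, hr, inv_pow, inv_inv]
      _ ≤ _ := by
          gcongr
          exact le_max_left _ _
  · intro hd0' hrd
    have hd0 : 0 < d := hr0.trans_le hrd
    have hI := hI₂ r u hr0 hr1 hu1 (norm_pos_iff.1 (by rw [huu]; positivity))
      (norm_pos_iff.1 (by rw [hud]; exact hd0))
    rw [hud, huu] at hI
    have q : ∀ p : ℝ, ε ≤ p → r ^ p * d ^ (-(N + p)) ≤ r ^ ε * d ^ (-(N + ε)) := by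
      have q1 : ∀ p : ℝ, r ^ p * d ^ (-(N + p)) = d ^ (-(N : ℝ)) * (r / d) ^ p := fun p => by
        rw [Real.div_rpow hr0.le hd0.le, neg_add, Real.rpow_add hd0, Real.rpow_neg hd0.le p]
        ring
      intro p hp
      rw [q1, q1]
      gcongr ?_ * ?_
      exact Real.rpow_le_rpow_of_exponent_ge (by positivity) ((div_le_one hd0).2 hrd) hp
    refine hk.trans ?_
    calc _ ≤ C₀ * (r ^ α * (C₂ * ((d * d') ^ (-(l + 1)) * (d ^ (-α) * r ^ (1 - (l + 1)) +
          d ^ (1 / 2 - (l + 1)) * r ^ (1 / 2 - α))))) := by gcongr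
      _ = C₀ * C₂ * (d' ^ (-(l + 1)) *
          ((r ^ α * r ^ (1 - (l + 1))) * (d ^ (-(l + 1)) * d ^ (-α)) +
          (r ^ α * r ^ (1 / 2 - α)) * (d ^ (-(l + 1)) * d ^ (1 / 2 - (l + 1))))) := by
          rw [Real.mul_rpow hd0.le hd0'.le]
          ring
      _ = C₀ * C₂ * (d' ^ (-(l + 1)) * (r ^ (α - l) * d ^ (-(N + (α - l))) +
          r ^ (1 / 2 : ℝ) * d ^ (-(N + 1 / 2 : ℝ)))) := by
          rw [← Real.rpow_add hr0, ← Real.rpow_add hr0, ← Real.rpow_add hd0, ← Real.rpow_add hd0,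
            show α + (1 - (l + 1)) = α - l by ring, show α + (1 / 2 - α) = 1 / 2 by ring,
            show -(l + 1) + -α = -(N + (α - l)) by linarith,
            show -(l + 1) + (1 / 2 - (l + 1)) = -(N + 1 / 2 : ℝ) by linarith]
      _ ≤ C₀ * C₂ * (d' ^ (-(l + 1)) * (r ^ ε * d ^ (-(N + ε)) + r ^ ε * d ^ (-(N + ε)))) := by
          gcongr _ * (_ * (?_ + ?_))
          · exact q _ (min_le_left _ _)
          · exact q _ (min_le_right _ _)
      _ = 2 * (C₀ * C₂) * (r ^ ε * (d' ^ (-(l + 1)) * d ^ (-(N + ε)))) := by ring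
      _ ≤ _ := by
          gcongr
          exact le_max_right _ _

theorem ofReal_mul_setLIntegral_sphMeasure_le {N : ℕ} {F : EuclideanSpace ℝ (Fin (N + 1)) → ℝ≥0∞}
    (hF : Measurable F) {g : Sph N → ℝ≥0∞} (hg : Measurable g) {S : Set (Sph N)}
    (hS : MeasurableSet S) {t r : ℝ} (ht : 1 ≤ t)
    (h : ∀ y ∈ S, ∀ s ∈ Set.Icc t (t + r), g y ≤ F (s • (y : EuclideanSpace ℝ (Fin (N + 1))))) :
    ENNReal.ofReal r * ∫⁻ y in S, g y ∂(sphMeasure N) ≤ ∫⁻ z, F z := by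
  rw [lintegral_polar N F hF, ← lintegral_const_mul _ hg]
  refine le_trans (setLIntegral_mono' hS fun y hy => ?_) (setLIntegral_le_lintegral S _)
  calc ENNReal.ofReal r * g y = ∫⁻ _ in Set.Icc t (t + r), g y := by
        rw [setLIntegral_const, Real.volume_Icc, mul_comm, add_sub_cancel_left]
    _ ≤ ∫⁻ s in Set.Icc t (t + r), ENNReal.ofReal (s ^ N) *
          F (s • (y : EuclideanSpace ℝ (Fin (N + 1)))) := by
        refine setLIntegral_mono' measurableSet_Icc fun s hs => ?_
        calc g y = 1 * g y := (one_mul _).symm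
          _ ≤ _ := by
            refine mul_le_mul' ?_ (h y hy s hs)
            rw [← ENNReal.ofReal_one]
            exact ENNReal.ofReal_le_ofReal (one_le_pow₀ (ht.trans hs.1))
    _ ≤ _ := lintegral_mono_set fun s hs => Set.mem_Ioi.2 (by linarith [hs.1])

theorem exists_sphMeasure_closedBall_le (N : ℕ) : ∃ C : ℝ, 0 < C ∧ ∀ (x : Sph N) (r : ℝ), 0 < r →
    sphMeasure N (closedBall x r) ≤ ENNReal.ofReal (C * r ^ N) := by
  set c := volume.real (ball (0 : EuclideanSpace ℝ (Fin (N + 1))) 1) with hc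
  have hc0 : 0 < c := ENNReal.toReal_pos (measure_ball_pos _ _ one_pos).ne' measure_ball_lt_top.ne
  refine ⟨2 ^ (N + 1) * c, by positivity, fun x r hr => ?_⟩
  have h := ofReal_mul_setLIntegral_sphMeasure_le (N := N) (t := 1) (r := r) (g := fun _ => 1)
    (F := (closedBall (x : EuclideanSpace ℝ (Fin (N + 1))) (2 * r)).indicator fun _ => 1)
    (measurable_const.indicator measurableSet_closedBall) measurable_const
    (measurableSet_closedBall (x := x) (ε := r)) le_rfl (fun y hy s hs => ?_)
  · rw [setLIntegral_const, one_mul, lintegral_indicator_const measurableSet_closedBall, one_mul,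
      Measure.addHaar_closedBall _ _ (by positivity), finrank_euclideanSpace, Fintype.card_fin,
      ← ENNReal.ofReal_toReal (measure_ball_lt_top (μ := (volume : Measure
        (EuclideanSpace ℝ (Fin (N + 1)))))).ne, ← ENNReal.ofReal_mul (by positivity)] at h
    have hr' : ENNReal.ofReal r ≠ 0 := by simpa using hr
    refine (ENNReal.mul_le_mul_iff_right hr' ENNReal.ofReal_ne_top).1 (h.trans_eq ?_)
    rw [← ENNReal.ofReal_mul hr.le]
    congr 1
    rw [hc, measureReal_def]
    ring
  · have hy1 : ‖(y : EuclideanSpace ℝ (Fin (N + 1)))‖ = 1 := by simp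
    rw [Set.indicator_of_mem]
    rw [mem_closedBall, dist_eq_norm]
    have h1 : dist (y : EuclideanSpace ℝ (Fin (N + 1))) x ≤ r := hy
    rw [dist_eq_norm] at h1
    calc ‖s • (y : EuclideanSpace ℝ (Fin (N + 1))) - x‖ =
          ‖(s - 1) • (y : EuclideanSpace ℝ (Fin (N + 1))) + (y - x)‖ := by
            congr 1; rw [sub_smul, one_smul]; abel
      _ ≤ (s - 1) * 1 + r := by
          refine (norm_add_le _ _).trans (add_le_add ?_ h1)
          rw [norm_smul, hy1, Real.norm_eq_abs, abs_of_nonneg (by linarith [hs.1])]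
      _ ≤ 2 * r := by linarith [hs.2]

/-- Almost every point of the sphere is a Lebesgue point of an integrable function. -/
theorem ae_tendsto_lintegral_closedBall_sphMeasure {N : ℕ} {f : Sph N → ℝ} (hfm : Measurable f)
    (hf : Integrable f (sphMeasure N)) : ∀ᵐ x ∂(sphMeasure N), ∀ η : ℝ, 0 < η →
      ∃ R : ℝ, 0 < R ∧ ∀ r, 0 < r → r ≤ R →
        ∫⁻ y in closedBall x r, ENNReal.ofReal |f y - f x| ∂(sphMeasure N) ≤
          ENNReal.ofReal (η * r ^ N) := by
  set f₁ : EuclideanSpace ℝ (Fin (N + 1)) → ℝ := Function.extend Subtype.val f 0 with hf₁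
  have hf₁m : Measurable f₁ := (MeasurableEmbedding.subtype_coe
    (isClosed_sphere.measurableSet)).measurable_extend hfm measurable_zero
  have hf₁e : ∀ y : Sph N, f₁ y = f y := fun y => Subtype.val_injective.extend_apply f 0 y
  set G : EuclideanSpace ℝ (Fin (N + 1)) → ℝ :=
    (ball 0 10).indicator fun z => f₁ (‖z‖⁻¹ • z) with hG
  have hGm : Measurable G := (hf₁m.comp (by fun_prop)).indicator measurableSet_ball
  have hGe : ∀ (y : Sph N) (s : ℝ), 0 < s → s < 10 →
      G (s • (y : EuclideanSpace ℝ (Fin (N + 1)))) = f y := by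
    intro y s hs hs10
    have hn : ‖s • (y : EuclideanSpace ℝ (Fin (N + 1)))‖ = s := by
      rw [norm_smul, Real.norm_eq_abs, abs_of_pos hs]; simp
    rw [hG, Set.indicator_of_mem (by rw [mem_ball_zero_iff, hn]; exact hs10), hn, smul_smul,
      inv_mul_cancel₀ hs.ne', one_smul, hf₁e]
  have hGint : Integrable G := by
    refine ⟨hGm.aestronglyMeasurable, ?_⟩
    rw [HasFiniteIntegral, lintegral_polar N _ hGm.enorm]
    have hle : ∀ y : Sph N, (∫⁻ r in Set.Ioi (0 : ℝ), ENNReal.ofReal (r ^ N) *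
        ‖G (r • (y : EuclideanSpace ℝ (Fin (N + 1))))‖ₑ) ≤
          ENNReal.ofReal (10 ^ (N + 1)) * ‖f y‖ₑ := by
      intro y
      calc _ ≤ ∫⁻ r in Set.Ioi (0 : ℝ), (Set.Iio 10).indicator
            (fun _ => ENNReal.ofReal (10 ^ N) * ‖f y‖ₑ) r := by
            refine setLIntegral_mono' measurableSet_Ioi fun r hr => ?_
            have hr : 0 < r := hr
            by_cases h10 : r < 10
            · rw [Set.indicator_of_mem (Set.mem_Iio.2 h10), hGe y r hr h10]
              gcongr
            · rw [hG, Set.indicator_of_notMem (s := ball 0 10)]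
              · simp
              · rw [mem_ball_zero_iff, norm_smul, Real.norm_eq_abs, abs_of_pos hr]
                simpa using h10
        _ = _ := by
            rw [lintegral_indicator measurableSet_Iio, setLIntegral_const,
              Measure.restrict_apply measurableSet_Iio, Set.Iio_inter_Ioi, Real.volume_Ioo,
              mul_right_comm, ← ENNReal.ofReal_mul (by positivity), sub_zero, pow_succ]
    refine (lintegral_mono hle).trans_lt ?_
    rw [lintegral_const_mul _ hfm.enorm]
    exact ENNReal.mul_lt_top ENNReal.ofReal_lt_top hf.2
  have hae := IsUnifLocDoublingMeasure.ae_tendsto_average_norm_sub (μ := volume)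
    hGint.locallyIntegrable 1
  obtain ⟨B, hB, hBm, hB0⟩ := exists_measurable_superset_of_null (ae_iff.1 hae)
  have hz := lintegral_polar N (B.indicator fun _ => 1) (measurable_const.indicator hBm)
  rw [lintegral_indicator_const hBm, hB0, mul_zero] at hz
  have hz' := (lintegral_eq_zero_iff' (by
    refine Measurable.aemeasurable ?_
    refine Measurable.lintegral_prod_right' (f := fun p : Sph N × ℝ => ENNReal.ofReal (p.2 ^ N) *
      B.indicator (fun _ => 1) (p.2 • (p.1 : EuclideanSpace ℝ (Fin (N + 1))))) ?_
    refine Measurable.mul (by fun_prop) ?_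
    exact (measurable_const.indicator hBm).comp (by fun_prop))).1 hz.symm
  filter_upwards [hz'] with x hx
  have hx' : ∫⁻ r in Set.Ioo (1 : ℝ) 2, B.indicator (fun _ => (1 : ℝ≥0∞))
      (r • (x : EuclideanSpace ℝ (Fin (N + 1)))) = 0 := by
    refine le_antisymm (le_trans ?_ hx.le) bot_le
    refine le_trans (setLIntegral_mono' (g := fun r => ENNReal.ofReal (r ^ N) *
      B.indicator (fun _ => (1 : ℝ≥0∞)) (r • (x : EuclideanSpace ℝ (Fin (N + 1)))))
      measurableSet_Ioo fun r hr => ?_) (lintegral_mono_set fun r hr => ?_)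
    · refine le_mul_of_one_le_left' ?_
      rw [← ENNReal.ofReal_one]
      exact ENNReal.ofReal_le_ofReal (one_le_pow₀ hr.1.le)
    · exact Set.mem_Ioi.2 (by linarith [hr.1])
  obtain ⟨t, ht1, ht2, htB⟩ : ∃ t : ℝ, 1 < t ∧ t < 2 ∧
      t • (x : EuclideanSpace ℝ (Fin (N + 1))) ∉ B := by
    by_contra! hcon
    have : ∫⁻ r in Set.Ioo (1 : ℝ) 2, B.indicator (fun _ => (1 : ℝ≥0∞))
      (r • (x : EuclideanSpace ℝ (Fin (N + 1)))) = ∫⁻ r in Set.Ioo (1 : ℝ) 2, 1 :=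
      setLIntegral_congr_fun measurableSet_Ioo fun r hr => by
        simp only [Set.indicator_of_mem (hcon r hr.1 hr.2)]
    rw [this, setLIntegral_const, Real.volume_Ioo] at hx'
    norm_num at hx'
  have hleb : ∀ {ι : Type} {k : Filter ι} (w : ι → EuclideanSpace ℝ (Fin (N + 1))) (δ : ι → ℝ),
      Tendsto δ k (𝓝[>] 0) → (∀ᶠ j in k, t • (x : EuclideanSpace ℝ (Fin (N + 1))) ∈
        closedBall (w j) (1 * δ j)) → Tendsto (fun j => ⨍ y in closedBall (w j) (δ j),
          ‖G y - G (t • (x : EuclideanSpace ℝ (Fin (N + 1))))‖) k (𝓝 0) := by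
    by_contra hcon
    exact htB (hB hcon)
  have hδ : Tendsto (fun r : ℝ => 3 * r) (𝓝[>] 0) (𝓝[>] 0) := by
    refine tendsto_nhdsWithin_iff.2 ⟨?_, ?_⟩
    · have : Tendsto (fun r : ℝ => 3 * r) (𝓝 0) (𝓝 (3 * 0)) := tendsto_id.const_mul 3
      rw [mul_zero] at this
      exact this.mono_left nhdsWithin_le_nhds
    · filter_upwards [self_mem_nhdsWithin] with r hr
      have hr : 0 < r := hr
      exact Set.mem_Ioi.2 (by positivity)
  have hlim := hleb (fun _ : ℝ => t • (x : EuclideanSpace ℝ (Fin (N + 1)))) (fun r => 3 * r) hδ (by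
    filter_upwards [self_mem_nhdsWithin] with r hr
    have hr : 0 < r := hr
    exact mem_closedBall_self (by positivity))
  set c := volume.real (ball (0 : EuclideanSpace ℝ (Fin (N + 1))) 1) with hc
  have hc0 : 0 < c := ENNReal.toReal_pos (measure_ball_pos _ _ one_pos).ne' measure_ball_lt_top.ne
  intro η hη
  have hev := hlim.eventually_lt_const (show 0 < η / (3 ^ (N + 1) * c) by positivity)
  obtain ⟨R, hR, hRs⟩ := mem_nhdsGT_iff_exists_Ioc_subset.1 hev
  have hR : 0 < R := hR
  refine ⟨min R 1, by positivity, fun r hr hrR => ?_⟩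
  have hr1 : r ≤ 1 := hrR.trans (min_le_right _ _)
  have hav := hRs ⟨hr, hrR.trans (min_le_left _ _)⟩
  simp only [Set.mem_ofPred_eq] at hav
  set D : Set (EuclideanSpace ℝ (Fin (N + 1))) :=
      closedBall (t • (x : EuclideanSpace ℝ (Fin (N + 1))))
    (3 * r) with hD
  have hDv : volume.real D = (3 * r) ^ (N + 1) * c := by
    rw [hD, measureReal_def, Measure.addHaar_closedBall _ _ (by positivity),
      finrank_euclideanSpace, Fintype.card_fin, ENNReal.toReal_mul,
      ENNReal.toReal_ofReal (by positivity), hc, measureReal_def]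
  have h := ofReal_mul_setLIntegral_sphMeasure_le (N := N) (t := t) (r := r)
    (g := fun y => ENNReal.ofReal |f y - f x|)
    (F := D.indicator fun z => ENNReal.ofReal
      ‖G z - G (t • (x : EuclideanSpace ℝ (Fin (N + 1))))‖)
    (Measurable.indicator (by fun_prop) measurableSet_closedBall) (by fun_prop)
    (measurableSet_closedBall (x := x) (ε := r)) ht1.le (fun y hy s hs => ?_)
  · have hGi : Integrable (fun z => ‖G z - G (t • (x : EuclideanSpace ℝ (Fin (N + 1))))‖)
        (volume.restrict D) :=
      (hGint.integrableOn.sub (integrableOn_const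
        (C := G (t • (x : EuclideanSpace ℝ (Fin (N + 1)))))
        measure_closedBall_lt_top.ne)).norm
    rw [lintegral_indicator measurableSet_closedBall,
      ← ofReal_integral_eq_lintegral_ofReal hGi (.of_forall fun z => norm_nonneg _)] at h
    have hI : ∫ z in D, ‖G z - G (t • (x : EuclideanSpace ℝ (Fin (N + 1))))‖ ≤ r * (η * r ^ N) := by
      rw [setAverage_eq, hDv, smul_eq_mul, inv_mul_lt_iff₀ (by positivity)] at hav
      refine hav.le.trans_eq ?_
      field_simp
      ring
    have hr' : ENNReal.ofReal r ≠ 0 := by simpa using hr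
    refine (ENNReal.mul_le_mul_iff_right hr' ENNReal.ofReal_ne_top).1 (h.trans ?_)
    rw [← ENNReal.ofReal_mul hr.le]
    exact ENNReal.ofReal_le_ofReal hI
  · have hy1 : ‖(y : EuclideanSpace ℝ (Fin (N + 1)))‖ = 1 := by simp
    have h1 : dist (y : EuclideanSpace ℝ (Fin (N + 1))) x ≤ r := hy
    rw [dist_eq_norm] at h1
    rw [Set.indicator_of_mem, hGe x t (by linarith) (by linarith),
      hGe y s (by linarith [hs.1]) (by linarith [hs.2]), Real.norm_eq_abs]
    rw [hD, mem_closedBall, dist_eq_norm]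
    calc ‖s • (y : EuclideanSpace ℝ (Fin (N + 1))) - t • (x : EuclideanSpace ℝ (Fin (N + 1)))‖ =
          ‖(s - t) • (y : EuclideanSpace ℝ (Fin (N + 1))) +
            t • (y - x : EuclideanSpace ℝ (Fin (N + 1)))‖ := by
            congr 1; rw [sub_smul, smul_sub]; abel
      _ ≤ (s - t) * 1 + t * r := by
          refine (norm_add_le _ _).trans (add_le_add ?_ ?_)
          · rw [norm_smul, hy1, Real.norm_eq_abs, abs_of_nonneg (by linarith [hs.1])]
          · rw [norm_smul, Real.norm_eq_abs, abs_of_nonneg (by linarith)]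
            gcongr
      _ ≤ 3 * r := by nlinarith [hs.2]

theorem lintegral_tsum_indicator_le {X : Type*} [MeasurableSpace X] (ν : Measure X)
    {T : ℕ → Set X} (hT : ∀ j, MeasurableSet (T j)) {c : ℕ → ℝ≥0∞} {q M : ℝ} (hq0 : 0 ≤ q)
    (hq1 : q < 1) (hM : 0 ≤ M) (h : ∀ j, c j * ν (T j) ≤ ENNReal.ofReal (M * q ^ j)) :
    ∫⁻ y, ∑' j, (T j).indicator (fun _ => c j) y ∂ν ≤ ENNReal.ofReal (M * (1 - q)⁻¹) := by
  rw [lintegral_tsum fun j => (measurable_const.indicator (hT j)).aemeasurable]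
  have hs : HasSum (fun j => M * q ^ j) (M * (1 - q)⁻¹) :=
    (hasSum_geometric_of_lt_one hq0 hq1).mul_left M
  rw [← hs.tsum_eq, ENNReal.ofReal_tsum_of_nonneg (fun j => by positivity) hs.summable]
  refine ENNReal.tsum_le_tsum fun j => ?_
  rw [lintegral_indicator_const (hT j)]
  exact h j

theorem setLIntegral_annulus_rpow_le {X : Type*} [PseudoMetricSpace X] [MeasurableSpace X]
    [OpensMeasurableSpace X] (ν : Measure X) (x : X) {N : ℕ} {ε η a R : ℝ} (hε : 0 < ε)
    (hη : 0 ≤ η) (ha : 0 < a)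
    (hν : ∀ r, 0 < r → r ≤ 2 * R → ν (closedBall x r) ≤ ENNReal.ofReal (η * r ^ N)) :
    ∫⁻ y in {y | a ≤ dist y x ∧ dist y x ≤ R}, ENNReal.ofReal (a ^ ε * dist y x ^ (-(N + ε))) ∂ν ≤
      ENNReal.ofReal (η * 2 ^ N * (1 - 2 ^ (-ε))⁻¹) := by
  classical
  set T : ℕ → Set X := fun j => if 2 ^ j * a ≤ R then closedBall x (2 ^ (j + 1) * a) else ∅ with hT
  have hTm : ∀ j, MeasurableSet (T j) := fun j => by
    simp only [hT]
    split_ifs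
    exacts [measurableSet_closedBall, MeasurableSet.empty]
  have hq0 : (0 : ℝ) ≤ 2 ^ (-ε) := by positivity
  have hq1 : (2 : ℝ) ^ (-ε) < 1 := Real.rpow_lt_one_of_one_lt_of_neg one_lt_two (by linarith)
  set c : ℕ → ℝ := fun j => (2 ^ (-ε)) ^ j * ((2 ^ j * a) ^ N)⁻¹ with hc
  have hSm : MeasurableSet {y | a ≤ dist y x ∧ dist y x ≤ R} :=
    (isClosed_le continuous_const (continuous_id.dist continuous_const)).measurableSet.inter
      (isClosed_le (continuous_id.dist continuous_const) continuous_const).measurableSet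
  refine le_trans (le_trans (setLIntegral_mono' hSm fun y hy => ?_) (setLIntegral_le_lintegral _ _))
    (lintegral_tsum_indicator_le ν hTm (c := fun j => ENNReal.ofReal (c j)) hq0 hq1
      (by positivity) fun j => ?_)
  · obtain ⟨hy1, hy2⟩ := hy
    have hd0 : 0 < dist y x := ha.trans_le hy1
    obtain ⟨j, hj1, hj2⟩ := exists_nat_pow_near ((one_le_div ha).2 hy1) (one_lt_two (α := ℝ))
    rw [le_div_iff₀ ha] at hj1
    rw [div_lt_iff₀ ha] at hj2
    refine le_trans ?_ (ENNReal.le_tsum j)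
    have hmem : y ∈ T j := by
      simp only [hT]
      rw [if_pos (hj1.trans hy2)]
      exact hj2.le
    rw [Set.indicator_of_mem hmem]
    refine ENNReal.ofReal_le_ofReal ?_
    have hja : 0 < 2 ^ j * a := by positivity
    calc a ^ ε * dist y x ^ (-(N + ε)) ≤ a ^ ε * (2 ^ j * a) ^ (-(N + ε)) := by
          gcongr ?_ * ?_
          exact Real.rpow_le_rpow_of_nonpos hja hj1 (by
            have : (0 : ℝ) ≤ N := N.cast_nonneg
            linarith)
      _ = c j := by
          have e : ((2 : ℝ) ^ (-ε)) ^ j = ((2 : ℝ) ^ j) ^ (-ε) := by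
            rw [← Real.rpow_natCast, ← Real.rpow_natCast, ← Real.rpow_mul zero_le_two,
              ← Real.rpow_mul zero_le_two, mul_comm]
          simp only [hc]
          rw [e, neg_add, Real.rpow_add hja, Real.rpow_neg hja.le, Real.rpow_natCast,
            Real.mul_rpow (by positivity) ha.le, Real.rpow_neg ha.le ε]
          field_simp
  · simp only [hT]
    split_ifs with hj
    · have h1 := hν (2 ^ (j + 1) * a) (by positivity) (by rw [pow_succ]; linarith)
      refine (mul_le_mul_right h1 _).trans ?_
      rw [← ENNReal.ofReal_mul (by positivity)]
      refine ENNReal.ofReal_le_ofReal (le_of_eq ?_)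
      simp only [hc]
      rw [pow_succ, mul_right_comm _ (2 : ℝ) a, mul_pow _ (2 : ℝ) N]
      field_simp
    · simp

theorem lintegral_dist_rpow_neg_le {X : Type*} [PseudoMetricSpace X] [MeasurableSpace X]
    [OpensMeasurableSpace X] (ν : Measure X) (x : X) {N : ℕ} {p C : ℝ} (hp : 0 < p) (hpN : p < N)
    (hC : 0 ≤ C) (hX : ∀ y, dist y x ≤ 2)
    (hν : ∀ r, 0 < r → ν (closedBall x r) ≤ ENNReal.ofReal (C * r ^ N)) :
    ∫⁻ y, ENNReal.ofReal (dist y x ^ (-p)) ∂ν ≤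
      ENNReal.ofReal (C * 2 ^ N * (1 - 2 ^ (p - N))⁻¹) := by
  have hq0 : (0 : ℝ) ≤ 2 ^ (p - N) := by positivity
  have hq1 : (2 : ℝ) ^ (p - N) < 1 := Real.rpow_lt_one_of_one_lt_of_neg one_lt_two (by linarith)
  refine le_trans (lintegral_mono fun y => ?_)
    (lintegral_tsum_indicator_le ν (T := fun j => closedBall x (2 * (1 / 2) ^ j))
      (c := fun j => ENNReal.ofReal ((2 ^ p) ^ j)) (fun j => measurableSet_closedBall) hq0 hq1
      (by positivity) fun j => ?_)
  · rcases (dist_nonneg (x := y) (y := x)).eq_or_lt with h0 | h0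
    · rw [← h0, Real.zero_rpow (by linarith)]
      simp
    · obtain ⟨j, hj1, hj2⟩ := exists_nat_pow_near_of_lt_one (half_pos h0)
        (by linarith [hX y] : dist y x / 2 ≤ 1) (one_half_pos (α := ℝ)) one_half_lt_one
      refine le_trans ?_ (ENNReal.le_tsum j)
      have hmem : y ∈ closedBall x (2 * (1 / 2) ^ j) := by
        rw [mem_closedBall]; linarith
      rw [Set.indicator_of_mem hmem]
      refine ENNReal.ofReal_le_ofReal ?_
      calc dist y x ^ (-p) ≤ ((1 / 2 : ℝ) ^ j) ^ (-p) :=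
            Real.rpow_le_rpow_of_nonpos (by positivity) (by rw [pow_succ] at hj1; linarith)
              (by linarith)
        _ = (2 ^ p) ^ j := by
            rw [one_div, inv_pow, Real.inv_rpow (by positivity), Real.rpow_neg (by positivity),
              inv_inv, ← Real.rpow_natCast, ← Real.rpow_natCast, ← Real.rpow_mul zero_le_two,
              ← Real.rpow_mul zero_le_two, mul_comm]
  · refine (mul_le_mul_right (hν (2 * (1 / 2) ^ j) (by positivity)) _).trans ?_
    rw [← ENNReal.ofReal_mul (by positivity)]
    refine ENNReal.ofReal_le_ofReal (le_of_eq ?_)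
    rw [Real.rpow_sub two_pos, Real.rpow_natCast, div_pow, div_pow, mul_pow, div_pow, one_pow,
      one_pow, ← pow_mul (2 : ℝ) j N, ← pow_mul (2 : ℝ) N j, mul_comm j N]
    field_simp

/-- Kernels with the decay of the Cesàro kernel concentrate at their pole. -/
theorem tendsto_lintegral_abs_kernel {N : ℕ} {K : ℕ → Sph N → ℝ} {x : Sph N} {ν : Measure (Sph N)}
    {C ε p : ℝ} (hC : 0 < C) (hε : 0 < ε) (hp : 0 ≤ p)
    (hK : ∀ᶠ n : ℕ in atTop, ∀ y : Sph N, |K n y| ≤ C * ((n : ℝ) + 1) ^ N ∧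
      (0 < ‖(x + y : EuclideanSpace ℝ (Fin (N + 1)))‖ →
        ((n : ℝ) + 1)⁻¹ ≤ ‖(x - y : EuclideanSpace ℝ (Fin (N + 1)))‖ →
        |K n y| ≤ C * ((((n : ℝ) + 1)⁻¹) ^ ε *
          (‖(x + y : EuclideanSpace ℝ (Fin (N + 1)))‖ ^ (-p) *
            ‖(x - y : EuclideanSpace ℝ (Fin (N + 1)))‖ ^ (-(N + ε))))))
    (hν : ∀ η : ℝ, 0 < η → ∃ R : ℝ, 0 < R ∧ ∀ r, 0 < r → r ≤ R →
      ν (closedBall x r) ≤ ENNReal.ofReal (η * r ^ N))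
    (hanti : ∀ᵐ y : Sph N ∂ν, 0 < ‖((x : EuclideanSpace ℝ (Fin (N + 1))) + y)‖)
    (hW : ∫⁻ y, ENNReal.ofReal (‖((x : EuclideanSpace ℝ (Fin (N + 1))) + y)‖ ^ (-p)) ∂ν ≠ ∞) :
    Tendsto (fun n => ∫⁻ y, ENNReal.ofReal |K n y| ∂ν) atTop (𝓝 0) := by
  have hdist : ∀ y : Sph N, ‖(x - y : EuclideanSpace ℝ (Fin (N + 1)))‖ = dist y x := fun y => by
    rw [dist_comm, Subtype.dist_eq, dist_eq_norm]
  simp only [hdist] at hK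
  set W := ∫⁻ y, ENNReal.ofReal (‖((x : EuclideanSpace ℝ (Fin (N + 1))) + y)‖ ^ (-p)) ∂ν with hWd
  have hq1 : (2 : ℝ) ^ (-ε) < 1 := Real.rpow_lt_one_of_one_lt_of_neg one_lt_two (by linarith)
  have hN0 : (0 : ℝ) ≤ N := N.cast_nonneg
  set Q : ℝ := 2 ^ N * (1 - 2 ^ (-ε))⁻¹ with hQ
  have hQ0 : 0 < Q := by
    have : 0 < 1 - (2 : ℝ) ^ (-ε) := by linarith
    positivity
  have hw0 : 0 ≤ W.toReal := ENNReal.toReal_nonneg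
  have hr0 : ∀ n : ℕ, 0 < ((n : ℝ) + 1)⁻¹ := fun n => by positivity
  have hrlim : Tendsto (fun n : ℕ => ((n : ℝ) + 1)⁻¹) atTop (𝓝 0) := by
    simpa only [one_div] using tendsto_one_div_add_atTop_nhds_zero_nat (𝕜 := ℝ)
  have main : ∀ δ : ℝ, 0 < δ → ∀ᶠ n in atTop, ∫⁻ y, ENNReal.ofReal |K n y| ∂ν ≤
      ENNReal.ofReal δ := by
    intro δ hδ
    set η := δ / (2 * C * (1 + Q)) with hη
    have hη0 : 0 < η := by positivity
    obtain ⟨R, hR, hνR⟩ := hν η hη0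
    set R₀ := min (R / 2) 1 with hR₀
    have hR₀p : 0 < R₀ := by positivity
    have hR₀R : 2 * R₀ ≤ R := by linarith [min_le_left (R / 2) 1]
    have hfar : Tendsto (fun n : ℕ => C * ((((n : ℝ) + 1)⁻¹) ^ ε * R₀ ^ (-(N + ε))) * W.toReal)
        atTop (𝓝 0) := by
      have h1 : Tendsto (fun n : ℕ => (((n : ℝ) + 1)⁻¹) ^ ε) atTop (𝓝 0) := by
        have := hrlim.rpow_const (p := ε) (Or.inr hε.le)
        rwa [Real.zero_rpow hε.ne'] at this
      have := ((h1.mul_const (R₀ ^ (-(N + ε)))).const_mul C).mul_const W.toReal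
      simpa using this
    filter_upwards [hK, hrlim.eventually_le_const hR₀p,
      hfar.eventually_le_const (half_pos hδ)] with n hKn hrn hfn
    set r := ((n : ℝ) + 1)⁻¹ with hr
    have hrp : 0 < r := hr0 n
    have hcover : (Set.univ : Set (Sph N)) ⊆ (closedBall x r ∪
        {y | r ≤ dist y x ∧ dist y x ≤ R₀}) ∪ {y | R₀ ≤ dist y x} := by
      intro y _
      rcases le_total (dist y x) r with h | h
      · exact Or.inl (Or.inl h)
      · rcases le_total (dist y x) R₀ with h' | h'
        · exact Or.inl (Or.inr ⟨h, h'⟩)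
        · exact Or.inr h'
    have hmid : MeasurableSet {y | r ≤ dist y x ∧ dist y x ≤ R₀} :=
      (isClosed_le continuous_const (continuous_id.dist continuous_const)).measurableSet.inter
        (isClosed_le (continuous_id.dist continuous_const) continuous_const).measurableSet
    have hfarm : MeasurableSet {y : Sph N | R₀ ≤ dist y x} :=
      (isClosed_le continuous_const (continuous_id.dist continuous_const)).measurableSet
    have b1 : ∫⁻ y in closedBall x r, ENNReal.ofReal |K n y| ∂ν ≤ ENNReal.ofReal (C * η) := by
      calc _ ≤ ∫⁻ _ in closedBall x r, ENNReal.ofReal (C * ((n : ℝ) + 1) ^ N) ∂ν :=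
            lintegral_mono fun y => ENNReal.ofReal_le_ofReal (hKn y).1
        _ = ENNReal.ofReal (C * ((n : ℝ) + 1) ^ N) * ν (closedBall x r) := setLIntegral_const _ _
        _ ≤ ENNReal.ofReal (C * ((n : ℝ) + 1) ^ N) * ENNReal.ofReal (η * r ^ N) := by
            gcongr
            exact hνR r hrp (by linarith)
        _ = ENNReal.ofReal (C * η) := by
            rw [← ENNReal.ofReal_mul (by positivity), hr, inv_pow]
            congr 1
            field_simp
    have b2 : ∫⁻ y in {y | r ≤ dist y x ∧ dist y x ≤ R₀}, ENNReal.ofReal |K n y| ∂ν ≤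
        ENNReal.ofReal (C * (η * Q)) := by
      calc _ ≤ ∫⁻ y in {y | r ≤ dist y x ∧ dist y x ≤ R₀}, ENNReal.ofReal C *
            ENNReal.ofReal (r ^ ε * dist y x ^ (-(N + ε))) ∂ν := by
            refine setLIntegral_mono' hmid fun y hy => ?_
            rw [← ENNReal.ofReal_mul hC.le]
            refine ENNReal.ofReal_le_ofReal ?_
            have h1 : 1 ≤ ‖(x + y : EuclideanSpace ℝ (Fin (N + 1)))‖ := by
              have h2 := parallelogram_law_with_norm ℝ (x : EuclideanSpace ℝ (Fin (N + 1))) y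
              rw [hdist] at h2
              have hx1 : ‖(x : EuclideanSpace ℝ (Fin (N + 1)))‖ = 1 := by simp
              have hy1 : ‖(y : EuclideanSpace ℝ (Fin (N + 1)))‖ = 1 := by simp
              rw [hx1, hy1] at h2
              have h3 : dist y x ≤ 1 := hy.2.trans (min_le_right _ _)
              nlinarith [dist_nonneg (x := y) (y := x),
                norm_nonneg (x + y : EuclideanSpace ℝ (Fin (N + 1)))]
            have h2 := (hKn y).2 (by linarith) hy.1
            have h3 : ‖(x + y : EuclideanSpace ℝ (Fin (N + 1)))‖ ^ (-p) ≤ 1 :=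
              Real.rpow_le_one_of_one_le_of_nonpos h1 (by linarith)
            calc _ ≤ _ := h2
              _ ≤ C * (r ^ ε * (1 * dist y x ^ (-(N + ε)))) := by gcongr
              _ = _ := by rw [one_mul]
        _ = ENNReal.ofReal C * ∫⁻ y in {y | r ≤ dist y x ∧ dist y x ≤ R₀},
              ENNReal.ofReal (r ^ ε * dist y x ^ (-(N + ε))) ∂ν :=
            lintegral_const_mul' _ _ ENNReal.ofReal_ne_top
        _ ≤ ENNReal.ofReal C * ENNReal.ofReal (η * 2 ^ N * (1 - 2 ^ (-ε))⁻¹) := by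
            gcongr
            exact setLIntegral_annulus_rpow_le ν x hε hη0.le hrp
              fun s hs hs' => hνR s hs (hs'.trans hR₀R)
        _ = _ := by rw [← ENNReal.ofReal_mul hC.le, hQ, mul_assoc η]
    have b3 : ∫⁻ y in {y | R₀ ≤ dist y x}, ENNReal.ofReal |K n y| ∂ν ≤
        ENNReal.ofReal (δ / 2) := by
      calc _ ≤ ∫⁻ y in {y | R₀ ≤ dist y x}, ENNReal.ofReal (C * (r ^ ε * R₀ ^ (-(N + ε)))) *
            ENNReal.ofReal (‖(x + y : EuclideanSpace ℝ (Fin (N + 1)))‖ ^ (-p)) ∂ν := by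
            refine setLIntegral_mono_ae' hfarm ?_
            filter_upwards [hanti] with y hy hyR
            have hyR : R₀ ≤ dist y x := hyR
            rw [← ENNReal.ofReal_mul (by positivity)]
            refine ENNReal.ofReal_le_ofReal ?_
            have h2 := (hKn y).2 hy (hrn.trans hyR)
            have h3 : dist y x ^ (-(N + ε)) ≤ R₀ ^ (-(N + ε)) :=
              Real.rpow_le_rpow_of_nonpos hR₀p hyR (by linarith)
            calc _ ≤ _ := h2
              _ ≤ C * (r ^ ε * (‖(x + y : EuclideanSpace ℝ (Fin (N + 1)))‖ ^ (-p) *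
                  R₀ ^ (-(N + ε)))) := by gcongr
              _ = _ := by ring
        _ = ENNReal.ofReal (C * (r ^ ε * R₀ ^ (-(N + ε)))) * ∫⁻ y in {y | R₀ ≤ dist y x},
            ENNReal.ofReal (‖(x + y : EuclideanSpace ℝ (Fin (N + 1)))‖ ^ (-p)) ∂ν :=
            lintegral_const_mul' _ _ ENNReal.ofReal_ne_top
        _ ≤ ENNReal.ofReal (C * (r ^ ε * R₀ ^ (-(N + ε)))) * W := by
            gcongr
            exact setLIntegral_le_lintegral _ _
        _ = ENNReal.ofReal (C * (r ^ ε * R₀ ^ (-(N + ε))) * W.toReal) := by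
            rw [ENNReal.ofReal_mul (p := C * (r ^ ε * R₀ ^ (-(N + ε)))) (by positivity),
              ENNReal.ofReal_toReal hW]
        _ ≤ _ := ENNReal.ofReal_le_ofReal hfn
    calc ∫⁻ y, ENNReal.ofReal |K n y| ∂ν = ∫⁻ y in Set.univ, ENNReal.ofReal |K n y| ∂ν := by
          rw [setLIntegral_univ]
      _ ≤ _ := lintegral_mono_set hcover
      _ ≤ _ := (lintegral_union_le _ _ _).trans (add_le_add (lintegral_union_le _ _ _) le_rfl)
      _ ≤ ENNReal.ofReal (C * η) + ENNReal.ofReal (C * (η * Q)) + ENNReal.ofReal (δ / 2) :=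
          add_le_add (add_le_add b1 b2) b3
      _ = ENNReal.ofReal δ := by
          rw [← ENNReal.ofReal_add (by positivity) (by positivity),
            ← ENNReal.ofReal_add (by positivity) (by positivity), hη]
          congr 1
          field_simp
          ring
  rw [ENNReal.tendsto_nhds_zero]
  intro e he
  obtain ⟨d, hd0, hde⟩ := ENNReal.lt_iff_exists_nnreal_btwn.1 he
  filter_upwards [main d (by simpa using hd0)] with n hn
  exact hn.trans (by rw [ENNReal.ofReal_coe_nnreal]; exact hde.le)

theorem sphMeasure_singleton {N : ℕ} (hN : N ≠ 0) (x : Sph N) : sphMeasure N {x} = 0 := by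
  obtain ⟨C, hC, h⟩ := exists_sphMeasure_closedBall_le N
  have h1 : Tendsto (fun r : ℝ => ENNReal.ofReal (C * r ^ N)) (𝓝[>] 0) (𝓝 0) := by
    have : Tendsto (fun r : ℝ => ENNReal.ofReal (C * r ^ N)) (𝓝 0)
        (𝓝 (ENNReal.ofReal (C * 0 ^ N))) :=
      (ENNReal.continuous_ofReal.comp (f := fun r : ℝ => C * r ^ N) (by fun_prop)).tendsto 0
    rw [zero_pow hN, mul_zero, ENNReal.ofReal_zero] at this
    exact this.mono_left nhdsWithin_le_nhds
  refine le_antisymm (ge_of_tendsto h1 ?_) bot_le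
  filter_upwards [self_mem_nhdsWithin] with r hr
  have hr : 0 < r := hr
  exact (measure_mono (Set.singleton_subset_iff.2 (mem_closedBall_self hr.le))).trans (h x r hr)

theorem norm_add_eq_dist_antipode {N : ℕ} (x y : Sph N) :
    ‖(x + y : EuclideanSpace ℝ (Fin (N + 1)))‖ = dist x (antipode y) := by
  rw [Subtype.dist_eq, dist_eq_norm, antipode, sub_neg_eq_add]

theorem ae_lintegral_mul_norm_add_rpow_ne_top {N : ℕ} {f : Sph N → ℝ} (hfm : Measurable f)
    (hf : Integrable f (sphMeasure N)) {p : ℝ} (hp : 0 < p) (hpN : p < N) :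
    ∀ᵐ x ∂(sphMeasure N), ∫⁻ y, ENNReal.ofReal |f y - f x| *
      ENNReal.ofReal (‖(x + y : EuclideanSpace ℝ (Fin (N + 1)))‖ ^ (-p)) ∂(sphMeasure N) ≠ ∞ := by
  obtain ⟨C, hC, hcap⟩ := exists_sphMeasure_closedBall_le N
  set Q := ENNReal.ofReal (C * 2 ^ N * (1 - 2 ^ (p - N))⁻¹) with hQ
  have hQ1 : ∀ y : Sph N, ∫⁻ x, ENNReal.ofReal
      (‖((x : EuclideanSpace ℝ (Fin (N + 1))) + y)‖ ^ (-p)) ∂(sphMeasure N) ≤ Q := by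
    intro y
    simp only [norm_add_eq_dist_antipode]
    refine lintegral_dist_rpow_neg_le _ _ hp hpN hC.le (fun z => ?_) fun r hr => hcap _ r hr
    rw [Subtype.dist_eq, dist_eq_norm]
    refine (norm_sub_le _ _).trans_eq ?_
    norm_num
  have hQ2 : ∀ x : Sph N, ∫⁻ y, ENNReal.ofReal
      (‖((x : EuclideanSpace ℝ (Fin (N + 1))) + y)‖ ^ (-p)) ∂(sphMeasure N) ≤ Q := by
    intro x
    simpa only [add_comm] using hQ1 x
  have hkm : Measurable fun q : Sph N × Sph N => ENNReal.ofReal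
      (‖((q.1 : EuclideanSpace ℝ (Fin (N + 1))) + q.2)‖ ^ (-p)) := by fun_prop
  have hFm : Measurable fun q : Sph N × Sph N => ENNReal.ofReal |f q.2| * ENNReal.ofReal
      (‖((q.1 : EuclideanSpace ℝ (Fin (N + 1))) + q.2)‖ ^ (-p)) :=
    Measurable.mul (by fun_prop) hkm
  have hdouble : ∫⁻ x, ∫⁻ y, ENNReal.ofReal |f y| * ENNReal.ofReal
      (‖((x : EuclideanSpace ℝ (Fin (N + 1))) + y)‖ ^ (-p)) ∂(sphMeasure N)
      ∂(sphMeasure N) ≠ ∞ := by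
    rw [lintegral_lintegral_swap hFm.aemeasurable]
    refine ne_top_of_le_ne_top (b := ∫⁻ y, ENNReal.ofReal |f y| * Q ∂(sphMeasure N)) ?_
      (lintegral_mono fun y => ?_)
    · rw [lintegral_mul_const _ (by fun_prop)]
      refine ENNReal.mul_ne_top ?_ ENNReal.ofReal_ne_top
      simpa only [Real.enorm_eq_ofReal_abs, HasFiniteIntegral, lt_top_iff_ne_top] using hf.2
    · rw [lintegral_const_mul' _ _ ENNReal.ofReal_ne_top]
      exact mul_le_mul_right (hQ1 y) _
  filter_upwards [ae_lt_top hFm.lintegral_prod_right' hdouble] with x hx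
  refine ne_top_of_le_ne_top (b := (∫⁻ y, ENNReal.ofReal |f y| * ENNReal.ofReal
      (‖((x : EuclideanSpace ℝ (Fin (N + 1))) + y)‖ ^ (-p)) ∂(sphMeasure N)) +
      ∫⁻ y, ENNReal.ofReal |f x| * ENNReal.ofReal
      (‖((x : EuclideanSpace ℝ (Fin (N + 1))) + y)‖ ^ (-p)) ∂(sphMeasure N)) ?_ ?_
  · refine ENNReal.add_ne_top.2 ⟨hx.ne, ?_⟩
    rw [lintegral_const_mul' _ _ ENNReal.ofReal_ne_top]
    exact ENNReal.mul_ne_top ENNReal.ofReal_ne_top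
      (ne_top_of_le_ne_top ENNReal.ofReal_ne_top (hQ2 x))
  · have hm : Measurable fun y : Sph N => ENNReal.ofReal |f y| * ENNReal.ofReal
        (‖((x : EuclideanSpace ℝ (Fin (N + 1))) + y)‖ ^ (-p)) :=
      hFm.comp ((measurable_const (a := x)).prodMk measurable_id)
    rw [← lintegral_add_left hm]
    refine lintegral_mono fun y => ?_
    rw [← add_mul]
    gcongr
    rw [← ENNReal.ofReal_add (abs_nonneg _) (abs_nonneg _)]
    exact ENNReal.ofReal_le_ofReal (abs_sub _ _)

section

variable {N : ℕ} {a : ℕ → ℕ} {Y : (k : ℕ) → Fin (a k) → Sph N → ℝ}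

theorem integrable_mul_of_continuous {f g : Sph N → ℝ} (hf : Integrable f (sphMeasure N))
    (hg : Continuous g) : Integrable (fun y => f y * g y) (sphMeasure N) := by
  obtain ⟨c, hc⟩ := isCompact_univ.exists_bound_of_continuousOn (f := g) hg.continuousOn
  exact hf.mul_bdd hg.aestronglyMeasurable (Eventually.of_forall fun y => hc y trivial)

theorem IsFourierLaplaceBasis.continuous_cesaroKernel (hY : IsFourierLaplaceBasis N a Y) (α : ℝ)
    (n : ℕ) (x : Sph N) : Continuous (cesaroKernel Y α n x) := by
  unfold cesaroKernel
  have := fun k j => (hY.harmonic k j).continuous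
  fun_prop

theorem IsFourierLaplaceBasis.cesaroMean_eq_integral (hY : IsFourierLaplaceBasis N a Y) (α : ℝ)
    (n : ℕ) {f : Sph N → ℝ} (hf : Integrable f (sphMeasure N)) (x : Sph N) :
    cesaroMean Y α f n x = ∫ y, cesaroKernel Y α n x y * f y ∂(sphMeasure N) := by
  have hi : ∀ k j, Integrable (fun y => f y * Y k j y) (sphMeasure N) := fun k j =>
    integrable_mul_of_continuous hf (hY.harmonic k j).continuous
  have h1 : ∀ y, cesaroKernel Y α n x y * f y = (cesaroA α n)⁻¹ *
      ∑ k ∈ Finset.range (n + 1), cesaroA α (n - k) * ∑ j, (f y * Y k j y) * Y k j x := by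
    intro y
    rw [cesaroKernel, mul_assoc, Finset.sum_mul]
    congr 1
    refine Finset.sum_congr rfl fun k _ => ?_
    rw [mul_assoc, Finset.sum_mul]
    congr 1
    exact Finset.sum_congr rfl fun j _ => by ring
  simp only [h1]
  rw [integral_const_mul, integral_finsetSum]
  · simp only [integral_const_mul, cesaroMean]
    congr 1
    refine Finset.sum_congr rfl fun k _ => ?_
    rw [integral_finsetSum _ fun j _ => (hi k j).mul_const _]
    simp only [integral_mul_const, flCoeff]
  · exact fun k _ => (integrable_finsetSum _ fun j _ => (hi k j).mul_const _).const_mul _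

theorem IsFourierLaplaceBasis.integral_cesaroKernel (hY : IsFourierLaplaceBasis N a Y) {l α : ℝ}
    (hl : 2 * l + 1 = N) (hl0 : 0 < l) (hα : -1 < α) (n : ℕ) (x : Sph N) :
    ∫ y, cesaroKernel Y α n x y ∂(sphMeasure N) = 1 := by
  have hω := sphMeasure_real_univ_pos N
  have hc : ∀ k, Continuous fun y => ∑ j, Y k j x * Y k j y := fun k => by
    have := fun j => (hY.harmonic k j).continuous
    fun_prop
  have hZ : ∀ k, ∫ y, ∑ j, Y k j x * Y k j y ∂(sphMeasure N) = if k = 0 then 1 else 0 := by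
    intro k
    have h1 : l * (sphMeasure N).real Set.univ * ∫ y, ∑ j, Y k j x * Y k j y ∂(sphMeasure N) =
        (k + l) * ∫ y : Sph N, gegenbauer l
          ⟪(y : EuclideanSpace ℝ (Fin (N + 1))), (x : EuclideanSpace ℝ (Fin (N + 1)))⟫ k
          ∂(sphMeasure N) := by
      rw [← integral_const_mul, ← integral_const_mul]
      refine integral_congr_ae (Eventually.of_forall fun y => ?_)
      simp only
      rw [hY.sum_mul_eq hl hl0 k x y, real_inner_comm]
    rcases k with _ | k
    · simp only [gegenbauer, integral_const, smul_eq_mul, Nat.cast_zero] at h1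
      have h2 : l * (sphMeasure N).real Set.univ ≠ 0 := by positivity
      refine mul_left_cancel₀ h2 ?_
      simp only [if_true]
      linarith
    · rw [integral_gegenbauer_eq_zero hl hl0 x, mul_zero] at h1
      have h2 : l * (sphMeasure N).real Set.univ ≠ 0 := by positivity
      simpa [h2] using h1
  simp only [cesaroKernel]
  rw [integral_const_mul, integral_finsetSum _ fun k _ =>
    ((hc k).integrable_sphMeasure).const_mul _]
  simp only [integral_const_mul, hZ, mul_ite, mul_one, mul_zero]
  rw [Finset.sum_ite_eq' (Finset.range (n + 1)) 0, if_pos (by simp), Nat.sub_zero,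
    inv_mul_cancel₀ (cesaroA_pos hα n).ne']

end

theorem cesaroMean_congr_ae {N : ℕ} {a : ℕ → ℕ} (Y : (k : ℕ) → Fin (a k) → Sph N → ℝ) (α : ℝ)
    {f g : Sph N → ℝ} (h : f =ᵐ[sphMeasure N] g) (n : ℕ) (x : Sph N) :
    cesaroMean Y α f n x = cesaroMean Y α g n x := by
  have : flCoeff Y f = flCoeff Y g := by
    funext k j
    exact integral_congr_ae (h.mono fun y hy => by simp only [hy])
  rw [cesaroMean, cesaroMean, this]

theorem IsFourierLaplaceBasis.ae_tendsto_cesaroMean {N : ℕ} {a : ℕ → ℕ}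
    {Y : (k : ℕ) → Fin (a k) → Sph N → ℝ} (hN : 2 ≤ N)
    (hY : IsFourierLaplaceBasis N a Y) {α : ℝ} (hα : ((N : ℝ) - 1) / 2 < α)
    {f : Sph N → ℝ} (hfm : Measurable f) (hf : Integrable f (sphMeasure N)) :
    ∀ᵐ x ∂(sphMeasure N),
      Tendsto (fun n : ℕ => cesaroMean Y α f n x) atTop (𝓝 (f x)) := by
  have hN' : (2 : ℝ) ≤ N := by exact_mod_cast hN
  set l : ℝ := ((N : ℝ) - 1) / 2 with hld
  have hl : 2 * l + 1 = N := by rw [hld]; ring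
  have hl0 : 1 / 2 ≤ l := by rw [hld]; linarith
  obtain ⟨C, ε, hC, hε, hK⟩ := hY.exists_abs_cesaroKernel_le hl hl0 hα
  filter_upwards [ae_tendsto_lintegral_closedBall_sphMeasure hfm hf,
    ae_lintegral_mul_norm_add_rpow_ne_top hfm hf (p := l + 1) (by linarith) (by linarith)]
    with x hx hWx
  have hdm : Measurable fun y => ENNReal.ofReal |f y - f x| := by fun_prop
  set ν := (sphMeasure N).withDensity fun y => ENNReal.ofReal |f y - f x| with hν
  have hKt : Tendsto (fun n => ∫⁻ y, ENNReal.ofReal |cesaroKernel Y α n x y| ∂ν) atTop (𝓝 0) := by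
    refine tendsto_lintegral_abs_kernel (p := l + 1) hC hε (by linarith)
      (hK.mono fun n hn y => hn x y) (fun η hη => ?_) ?_ ?_
    · obtain ⟨R, hR, h⟩ := hx η hη
      refine ⟨R, hR, fun r hr hrR => ?_⟩
      rw [hν, withDensity_apply _ isClosed_closedBall.measurableSet]
      exact h r hr hrR
    · refine (withDensity_absolutelyContinuous (sphMeasure N) _).ae_le ?_
      have h0 : ∀ᵐ y ∂(sphMeasure N), y ≠ antipode x :=
        compl_mem_ae_iff.2 (sphMeasure_singleton (by omega) (antipode x))
      filter_upwards [h0] with y hy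
      rw [norm_pos_iff]
      intro h
      refine hy (Subtype.ext ?_)
      rw [antipode]
      exact (neg_eq_of_add_eq_zero_right h).symm
    · rw [hν, lintegral_withDensity_eq_lintegral_mul _ hdm (by fun_prop)]
      exact hWx
  have hbound : ∀ n, ENNReal.ofReal |cesaroMean Y α f n x - f x| ≤
      ∫⁻ y, ENNReal.ofReal |cesaroKernel Y α n x y| ∂ν := by
    intro n
    have hKc := hY.continuous_cesaroKernel α n x
    have h1 : cesaroMean Y α f n x - f x =
        ∫ y, cesaroKernel Y α n x y * (f y - f x) ∂(sphMeasure N) := by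
      have h2 : Integrable (fun y => cesaroKernel Y α n x y * f y) (sphMeasure N) := by
        simpa only [mul_comm] using integrable_mul_of_continuous hf hKc
      simp only [mul_sub]
      rw [integral_sub h2 (hKc.integrable_sphMeasure.mul_const _), integral_mul_const,
        hY.integral_cesaroKernel hl (by linarith) (by linarith), one_mul,
        hY.cesaroMean_eq_integral α n hf]
    rw [hν, lintegral_withDensity_eq_lintegral_mul _ hdm
      (by exact (ENNReal.continuous_ofReal.comp hKc.abs).measurable), h1,
      ← Real.enorm_eq_ofReal_abs]
    refine (enorm_integral_le_lintegral_enorm _).trans_eq (lintegral_congr fun y => ?_)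
    rw [enorm_mul, Real.enorm_eq_ofReal_abs, Real.enorm_eq_ofReal_abs, mul_comm]
    rfl
  have h0 : Tendsto (fun n => ENNReal.ofReal |cesaroMean Y α f n x - f x|) atTop (𝓝 0) :=
    tendsto_of_tendsto_of_tendsto_of_le_of_le tendsto_const_nhds hKt (fun _ => zero_le) hbound
  have h3 := (ENNReal.tendsto_toReal ENNReal.zero_ne_top).comp h0
  rw [tendsto_iff_norm_sub_tendsto_zero]
  refine h3.congr fun n => ?_
  simp [ENNReal.toReal_ofReal (abs_nonneg _)]

/-- For `N ≥ 2`, `f ∈ L¹(S^N)` and `α > (N−1)/2`, the Fourier–Laplace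
series of `f` is Cesàro summable of order `α` to `f` almost everywhere on the sphere. -/
theorem cesaro_summable_ae_of_L1
    (N : ℕ) (hN : 2 ≤ N) (a : ℕ → ℕ) (Y : (k : ℕ) → Fin (a k) → Sph N → ℝ)
    (hY : IsFourierLaplaceBasis N a Y) (α : ℝ) (hα : ((N : ℝ) - 1) / 2 < α)
    (f : Sph N → ℝ) (hf : Integrable f (sphMeasure N)) :
    ∀ᵐ x ∂(sphMeasure N),
      Tendsto (fun n : ℕ => cesaroMean Y α f n x) atTop (𝓝 (f x)) := by
  have hg := hf.1.ae_eq_mk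
  filter_upwards [hY.ae_tendsto_cesaroMean hN hα hf.1.stronglyMeasurable_mk.measurable
    (hf.congr hg), hg] with x hx hgx
  rw [hgx]
  exact hx.congr fun n => (cesaroMean_congr_ae Y α hg n x).symm
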